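/- Let A, B ⊆ ℝ^d be finite sets with dim(A) = d and |A| = |B|, and suppose |A + B| ≤ |A| + (d + 1/7)|B| - C_d for a suitable constant C_d depending only on d. Then either |A| is bounded by a constant depending only on d, or there is a line l through the origin and points x, y ∈ ℝ^d such that |A ∩ (x + l)| ≥ |A|/d and |B ∩ (y + l)| ≥ |B|/d. -/

import Mathlib

open Pointwise
open scoped Classical

namespace SumsetLines

lemma nsmul_injective_of_ne_zero {G : Type*} [AddCommGroup G] [IsAddTorsionFree G] {f : G}
    (hf : f ≠ 0) : Function.Injective fun i : ℕ ↦ i • f := by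
  intro i j hij
  by_contra hne
  have h : ((i : ℤ) - j) • f = ((i : ℤ) - j) • (0 : G) := by
    simpa [sub_smul, sub_eq_zero] using hij
  exact hf (zsmul_right_injective (by omega) h)

section Compression

variable {G : Type*} [AddCommGroup G] [DecidableEq G]

/-- The compression of `A` along `f`: every fibre of the idempotent endomorphism `p` is replaced by
an initial segment `c, c + f, c + 2f, …` of the same size. -/
def compress (p : G →+ G) (f : G) (A : Finset G) : Finset G :=
  (A.image p).biUnion fun c ↦ (Finset.range (A.filter (p · = c)).card).image fun i ↦ c + i • f

variable {p : G →+ G} {f : G} {A B : Finset G}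

lemma mem_compress (hp : ∀ x, p (p x) = p x) (hf : p f = 0) {x : G} :
    x ∈ compress p f A ↔ ∃ i < (A.filter (p · = p x)).card, x = p x + i • f := by
  simp only [compress, Finset.mem_biUnion, Finset.mem_image, Finset.mem_range]
  constructor
  · rintro ⟨_, ⟨a, -, rfl⟩, i, hi, rfl⟩
    have : p (p a + i • f) = p a := by simp [hp, hf]
    exact ⟨i, by rwa [this], by rw [this]⟩
  · rintro ⟨i, hi, hx⟩
    obtain ⟨a, ha⟩ := Finset.card_pos.1 (by omega : 0 < (A.filter (p · = p x)).card)
    rw [Finset.mem_filter] at ha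
    exact ⟨p x, ⟨a, ha⟩, i, hi, hx.symm⟩

lemma mem_compress_of_fixed (hp : ∀ x, p (p x) = p x) (hf : p f = 0) {a : G} (ha : a ∈ A)
    (h : p a = a) : a ∈ compress p f A :=
  (mem_compress hp hf).2 ⟨0, Finset.card_pos.2 ⟨a, by simp [ha]⟩, by simp [h]⟩

lemma add_mem_compress (hp : ∀ x, p (p x) = p x) (hf : p f = 0) {a b : G} (ha : a ∈ A)
    (hb : b ∈ A) (hab : a ≠ b) (h : p a = p b) (h' : p a = a) : a + f ∈ compress p f A := by
  have hpa : p (a + f) = a := by simp [hf, h']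
  refine (mem_compress hp hf).2 ⟨1, Finset.one_lt_card.2 ⟨a, ?_, b, ?_, hab⟩, ?_⟩
  · simp [ha, hf]
  · simp [hb, hf, h]
  · simp [hpa]

lemma compress_filter (hp : ∀ x, p (p x) = p x) (hf : p f = 0) (P : G → Prop) [DecidablePred P]
    (hP : ∀ x, P (p x) ↔ P x) : compress p f (A.filter P) = (compress p f A).filter P := by
  ext x
  rw [Finset.mem_filter, mem_compress hp hf, mem_compress hp hf, Finset.filter_filter]
  by_cases hx : P x
  · have : A.filter (fun a ↦ P a ∧ p a = p x) = A.filter (p · = p x) := by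
      refine Finset.filter_congr fun a _ ↦ ⟨And.right, fun h ↦ ⟨?_, h⟩⟩
      rwa [← hP, h, hP]
    simp [this, hx]
  · have : A.filter (fun a ↦ P a ∧ p a = p x) = ∅ := by
      refine Finset.filter_eq_empty_iff.2 fun a _ ↦ ?_
      rintro ⟨h, h'⟩
      exact hx (by rwa [← hP, ← h', hP])
    simp [this, hx]

lemma compress_sub_mem (hp : ∀ x, p (p x) = p x) (hf : p f = 0) (P : G → Prop)
    (hP : ∀ x, P (p x) ↔ P x) {e : G} (he : p e = e) (hA : ∀ a ∈ A, P a → a - e ∈ A) :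
    ∀ a ∈ compress p f A, P a → a - e ∈ compress p f A := by
  intro x hx hPx
  rw [mem_compress hp hf] at hx ⊢
  obtain ⟨i, hi, hxi⟩ := hx
  refine ⟨i, hi.trans_le ?_, ?_⟩
  · refine Finset.card_le_card_of_injOn (· - e) ?_ (fun a _ b _ h ↦ sub_left_injective h)
    intro a ha
    simp only [Finset.coe_filter, Set.mem_ofPred_eq] at ha ⊢
    exact ⟨hA a ha.1 (by rwa [← hP, ha.2, hP]), by rw [map_sub, map_sub, ha.2]⟩
  · rw [map_sub, he]
    nth_rw 1 [hxi]
    abel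

variable [IsAddTorsionFree G]

lemma card_fiber_compress (hp : ∀ x, p (p x) = p x) (hf : p f = 0) (hf0 : f ≠ 0) (c : G) :
    ((compress p f A).filter (p · = c)).card = (A.filter (p · = c)).card := by
  by_cases hc : p c = c
  · have : (compress p f A).filter (p · = c) =
        (Finset.range (A.filter (p · = c)).card).image fun i ↦ c + i • f := by
      ext x
      rw [Finset.mem_filter, mem_compress hp hf, Finset.mem_image]
      constructor
      · rintro ⟨⟨i, hi, hx⟩, rfl⟩
        exact ⟨i, by simpa using hi, hx.symm⟩
      · rintro ⟨i, hi, rfl⟩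
        have : p (c + i • f) = c := by simp [hf, hc]
        exact ⟨⟨i, by rw [this]; simpa using hi, by rw [this]⟩, this⟩
    rw [this, Finset.card_image_of_injective, Finset.card_range]
    intro i j hij
    exact nsmul_injective_of_ne_zero hf0 (add_left_cancel hij)
  · have h (S : Finset G) : S.filter (p · = c) = ∅ :=
      Finset.filter_eq_empty_iff.2 fun a _ h ↦ hc (by rw [← h, hp])
    rw [h, h]

lemma card_compress (hp : ∀ x, p (p x) = p x) (hf : p f = 0) (hf0 : f ≠ 0) :
    (compress p f A).card = A.card := by
  set T := (compress p f A).image p ∪ A.image p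
  rw [Finset.card_eq_sum_card_fiberwise (f := p) (s := A) (t := T)
      fun a ha ↦ Finset.mem_union_right _ (Finset.mem_image_of_mem _ ha),
    Finset.card_eq_sum_card_fiberwise (f := p) (t := T)
      fun a ha ↦ Finset.mem_union_left _ (Finset.mem_image_of_mem _ ha)]
  exact Finset.sum_congr rfl fun c _ ↦ card_fiber_compress hp hf hf0 c

lemma compress_add_subset (hp : ∀ x, p (p x) = p x) (hf : p f = 0) :
    compress p f A + compress p f B ⊆ compress p f (A + B) := by
  intro z hz
  obtain ⟨x, hx, y, hy, rfl⟩ := Finset.mem_add.1 hz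
  rw [mem_compress hp hf] at hx hy ⊢
  obtain ⟨i, hi, hx⟩ := hx
  obtain ⟨j, hj, hy⟩ := hy
  refine ⟨i + j, ?_, ?_⟩
  · have h := cauchy_davenport_of_isAddTorsionFree
      (Finset.card_pos.1 (by omega : 0 < (A.filter (p · = p x)).card))
      (Finset.card_pos.1 (by omega : 0 < (B.filter (p · = p y)).card))
    refine lt_of_lt_of_le (by omega) (h.trans (Finset.card_le_card ?_))
    intro w hw
    obtain ⟨a, ha, b, hb, rfl⟩ := Finset.mem_add.1 hw
    rw [Finset.mem_filter] at ha hb ⊢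
    exact ⟨Finset.add_mem_add ha.1 hb.1, by rw [map_add, map_add, ha.2, hb.2]⟩
  · nth_rw 1 [hx, hy]
    rw [map_add, add_smul]
    abel

lemma card_compress_add_le (hp : ∀ x, p (p x) = p x) (hf : p f = 0) (hf0 : f ≠ 0) :
    (compress p f A + compress p f B).card ≤ (A + B).card :=
  (Finset.card_le_card (compress_add_subset hp hf)).trans (card_compress hp hf hf0).le

end Compression

section Coordinate

variable {G : Type*} [AddCommGroup G]

/-- The projection `x ↦ x - k x • f` along `f` defined by an integral coordinate `k`. -/
def projAlong (k : G →+ ℤ) (f : G) : G →+ G :=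
  AddMonoidHom.mk' (fun x ↦ x - k x • f) fun x y ↦ by rw [map_add, add_smul]; abel

variable {k : G →+ ℤ} {f : G}

lemma projAlong_apply (x : G) : projAlong k f x = x - k x • f := rfl

lemma projAlong_self (hk : k f = 1) : projAlong k f f = 0 := by simp [projAlong_apply, hk]

lemma projAlong_projAlong (hk : k f = 1) (x : G) :
    projAlong k f (projAlong k f x) = projAlong k f x := by
  simp [projAlong_apply, hk]

lemma eq_of_projAlong_eq {a b : G} (h : projAlong k f a = projAlong k f b) (h' : k a = k b) :
    a = b := by
  simp only [projAlong_apply, h'] at h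
  exact sub_left_injective h

lemma ne_zero_of_coord (hk : k f = 1) : f ≠ 0 := by
  rintro rfl
  simp at hk

variable [DecidableEq G] {A : Finset G}

/-- The elements of `A` lying below `a` in the fibre of `a` of the projection along `f`. -/
def below (k : G →+ ℤ) (f : G) (A : Finset G) (a : G) : Finset G :=
  A.filter fun b ↦ projAlong k f b = projAlong k f a ∧ k b < k a

lemma image_below_subset (hA : ∀ a ∈ A, 0 ≤ k a) (a : G) :
    (below k f A a).image k ⊆ Finset.Ico 0 (k a) := by
  intro z hz
  obtain ⟨b, hb, rfl⟩ := Finset.mem_image.1 hz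
  simp only [below, Finset.mem_filter] at hb
  exact Finset.mem_Ico.2 ⟨hA b hb.1, hb.2.2⟩

lemma card_image_below (a : G) : ((below k f A a).image k).card = (below k f A a).card := by
  refine Finset.card_image_of_injOn fun b hb c hc h ↦ ?_
  simp only [below, Finset.coe_filter, Set.mem_ofPred_eq] at hb hc
  exact eq_of_projAlong_eq (hb.2.1.trans hc.2.1.symm) h

lemma card_below_le (hA : ∀ a ∈ A, 0 ≤ k a) {a : G} (ha : a ∈ A) :
    ((below k f A a).card : ℤ) ≤ k a := by
  have h := Finset.card_le_card (image_below_subset (f := f) hA a)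
  rw [card_image_below, Int.card_Ico] at h
  have := hA a ha
  omega

lemma sub_mem_of_card_below_eq (hk : k f = 1) (hA : ∀ a ∈ A, 0 ≤ k a) {a : G}
    (h1 : 1 ≤ k a) (h : ((below k f A a).card : ℤ) = k a) : a - f ∈ A := by
  have heq : (below k f A a).image k = Finset.Ico 0 (k a) := by
    refine Finset.eq_of_subset_of_card_le (image_below_subset hA a) ?_
    rw [card_image_below, Int.card_Ico]
    omega
  have hmem : k a - 1 ∈ (below k f A a).image k := by
    rw [heq, Finset.mem_Ico]
    omega
  obtain ⟨b, hb, hb'⟩ := Finset.mem_image.1 hmem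
  simp only [below, Finset.mem_filter] at hb
  have : b = a - f := by
    refine eq_of_projAlong_eq (k := k) (f := f) ?_ (by simp [hb', hk])
    rw [hb.2.1, map_sub, projAlong_self hk, sub_zero]
  exact this ▸ hb.1

/-- The position to which compression moves an element of `A`. -/
def slide (k : G →+ ℤ) (f : G) (A : Finset G) (a : G) : G :=
  projAlong k f a + (below k f A a).card • f

lemma slide_eq (a : G) : slide k f A a = a - (k a - (below k f A a).card) • f := by
  simp only [slide, projAlong_apply, sub_smul, natCast_zsmul]
  abel

lemma projAlong_slide (hk : k f = 1) (a : G) :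
    projAlong k f (slide k f A a) = projAlong k f a := by
  simp [slide, projAlong_projAlong hk, projAlong_self hk]

lemma slide_mem_compress (hk : k f = 1) {a : G} (ha : a ∈ A) :
    slide k f A a ∈ compress (projAlong k f) f A := by
  refine (mem_compress (projAlong_projAlong hk) (projAlong_self hk)).2
    ⟨(below k f A a).card, ?_, by rw [projAlong_slide hk, slide]⟩
  rw [projAlong_slide hk]
  refine Finset.card_lt_card ⟨fun b hb ↦ ?_, fun h ↦ ?_⟩
  · simp only [below, Finset.mem_filter] at hb ⊢
    exact ⟨hb.1, hb.2.1⟩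
  · have := h (Finset.mem_filter.2 ⟨ha, rfl⟩)
    simp [below] at this

variable [IsAddTorsionFree G]

lemma slide_injOn (hk : k f = 1) : Set.InjOn (slide k f A) A := by
  intro a ha b hb hab
  have hp : projAlong k f a = projAlong k f b := by
    rw [← projAlong_slide (A := A) hk a, hab, projAlong_slide hk]
  have hc : (below k f A a).card = (below k f A b).card := by
    simp only [slide, hp] at hab
    exact nsmul_injective_of_ne_zero (ne_zero_of_coord hk) (add_left_cancel hab)
  have key : ∀ a b : G, a ∈ A → projAlong k f a = projAlong k f b →
      (below k f A a).card = (below k f A b).card → ¬ k a < k b := by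
    intro a b ha hp hc hlt
    refine hc.not_lt (Finset.card_lt_card ⟨fun c hc ↦ ?_, fun h ↦ ?_⟩)
    · simp only [below, Finset.mem_filter] at hc ⊢
      exact ⟨hc.1, hc.2.1.trans hp, hc.2.2.trans hlt⟩
    · have := h (Finset.mem_filter.2 ⟨ha, hp, hlt⟩)
      simp [below] at this
  exact eq_of_projAlong_eq hp (le_antisymm (not_lt.1 (key b a hb hp.symm hc.symm))
    (not_lt.1 (key a b ha hp hc)))

lemma image_slide (hk : k f = 1) : A.image (slide k f A) = compress (projAlong k f) f A := by
  refine Finset.eq_of_subset_of_card_le (fun x hx ↦ ?_) ?_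
  · obtain ⟨a, ha, rfl⟩ := Finset.mem_image.1 hx
    exact slide_mem_compress hk ha
  · rw [card_compress (projAlong_projAlong hk) (projAlong_self hk) (ne_zero_of_coord hk),
      Finset.card_image_of_injOn (slide_injOn hk)]

lemma sum_compress (hk : k f = 1) (w : G →+ ℤ) :
    ∑ x ∈ compress (projAlong k f) f A, w x =
      ∑ a ∈ A, w a - ∑ a ∈ A, (k a - (below k f A a).card) * w f := by
  rw [← image_slide hk, Finset.sum_image (slide_injOn hk), ← Finset.sum_sub_distrib]
  refine Finset.sum_congr rfl fun a _ ↦ ?_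
  rw [slide_eq, map_sub, map_zsmul, smul_eq_mul]

lemma sum_compress_le (hk : k f = 1) (hA : ∀ a ∈ A, 0 ≤ k a) {w : G →+ ℤ} (hw : 0 < w f) :
    ∑ x ∈ compress (projAlong k f) f A, w x ≤ ∑ a ∈ A, w a := by
  rw [sum_compress hk]
  have : 0 ≤ ∑ a ∈ A, (k a - (below k f A a).card) * w f :=
    Finset.sum_nonneg fun a ha ↦ mul_nonneg (sub_nonneg.2 (card_below_le hA ha)) hw.le
  omega

lemma sum_compress_lt (hk : k f = 1) (hA : ∀ a ∈ A, 0 ≤ k a) {w : G →+ ℤ} (hw : 0 < w f)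
    {a : G} (ha : a ∈ A) (h1 : 1 ≤ k a) (hmem : a - f ∉ A) :
    ∑ x ∈ compress (projAlong k f) f A, w x < ∑ a ∈ A, w a := by
  rw [sum_compress hk]
  have hlt : ((below k f A a).card : ℤ) < k a :=
    (card_below_le hA ha).lt_of_ne fun h ↦ hmem (sub_mem_of_card_below_eq hk hA h1 h)
  have : 0 < ∑ a ∈ A, (k a - (below k f A a).card) * w f :=
    Finset.sum_pos' (fun a ha ↦ mul_nonneg (sub_nonneg.2 (card_below_le hA ha)) hw.le)
      ⟨a, ha, mul_pos (sub_pos.2 hlt) hw⟩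
  omega

end Coordinate

section RichDirection

variable {G : Type*} [AddCommGroup G]

/-- The elements `a` of `A` for which `a - s` is an element of `A` as well. -/
noncomputable def shiftInter (A : Finset G) (s : G) : Finset G := A.filter (· - s ∈ A)

lemma card_addEnergy_fiber_le (A : Finset G) (b₁ b₂ : G) :
    ((A ×ˢ A).filter fun x ↦ x.1 + b₁ = x.2 + b₂).card ≤ (shiftInter A (b₂ - b₁)).card := by
  refine Finset.card_le_card_of_injOn Prod.fst ?_ ?_
  · intro x hx
    simp only [Finset.coe_filter, Finset.mem_product, Set.mem_ofPred_eq, shiftInter] at hx ⊢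
    refine ⟨hx.1.1, ?_⟩
    have : x.1 - (b₂ - b₁) = x.2 := by rw [sub_sub_eq_add_sub, hx.2, add_sub_cancel_right]
    exact this ▸ hx.1.2
  · intro x hx y hy hxy
    simp only [Finset.coe_filter, Finset.mem_product, Set.mem_ofPred_eq] at hx hy
    refine Prod.ext hxy (add_right_cancel (b := b₂) ?_)
    rw [← hx.2, ← hy.2, hxy]

lemma addEnergy_le (A B : Finset G) {m : ℕ} (hm : ∀ s ≠ 0, (shiftInter A s).card ≤ m) :
    A.addEnergy B ≤ A.card * B.card + B.card ^ 2 * m := by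
  have h : A.addEnergy B =
      ∑ y ∈ B ×ˢ B, ((A ×ˢ A).filter fun x ↦ x.1 + y.1 = x.2 + y.2).card := by
    simp only [Finset.addEnergy, Finset.card_filter]
    rw [Finset.sum_product, Finset.sum_comm]
  rw [h]
  calc _ ≤ ∑ y ∈ B ×ˢ B, ((if y.1 = y.2 then A.card else 0) + m) := by
        refine Finset.sum_le_sum fun y _ ↦ (card_addEnergy_fiber_le A y.1 y.2).trans ?_
        split_ifs with hy
        · exact le_add_right (Finset.card_le_card (Finset.filter_subset _ _))
        · exact (hm _ (sub_ne_zero.2 (Ne.symm hy))).trans (by omega)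
    _ = _ := by
        rw [Finset.sum_add_distrib, ← Finset.sum_filter, Finset.sum_const, Finset.sum_const,
          Finset.card_product, smul_eq_mul, smul_eq_mul, mul_comm A.card, sq]
        congr 2
        rw [← Finset.diag_card B]
        refine congrArg Finset.card (Finset.ext fun y ↦ ?_)
        rw [Finset.mem_filter, Finset.mem_diag, Finset.mem_product]
        grind

lemma exists_card_shiftInter_ge {A B : Finset G} {K t : ℝ} (hK : 0 < K) (ht : 0 < t)
    (hA : t * B.card ≤ A.card) (hB : 2 * K < t * B.card) (hAB : (A + B).card ≤ K * B.card) :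
    ∃ s ≠ 0, t ^ 2 / (2 * K) * B.card ≤ (shiftInter A s).card := by
  by_contra! hcon
  set m := ⌊t ^ 2 / (2 * K) * B.card⌋₊
  have hm : ∀ s ≠ 0, (shiftInter A s).card ≤ m := fun s hs ↦ Nat.le_floor (hcon s hs).le
  have hm' : (m : ℝ) ≤ t ^ 2 / (2 * K) * B.card := Nat.floor_le (by positivity)
  have h1 : ((A.card ^ 2 * B.card ^ 2 : ℕ) : ℝ) ≤
      ((A + B).card * (A.card * B.card + B.card ^ 2 * m) : ℕ) :=
    Nat.cast_le.2 ((Finset.le_card_add_mul_addEnergy A B).trans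
      (Nat.mul_le_mul_left _ (addEnergy_le A B hm)))
  push_cast at h1
  have hB0 : 0 < (B.card : ℝ) := by
    by_contra! h
    nlinarith
  set a : ℝ := (A.card : ℝ)
  set N : ℝ := (B.card : ℝ)
  have ha : 0 < a := by nlinarith
  have h2 : a ^ 2 * N ^ 2 ≤ K * N * (a * N + N ^ 2 * (t ^ 2 / (2 * K) * N)) :=
    h1.trans (by gcongr)
  have h3 : K * N * (a * N + N ^ 2 * (t ^ 2 / (2 * K) * N)) =
      N ^ 2 * (K * a + (t * N) ^ 2 / 2) := by
    field_simp
  rw [h3, mul_comm] at h2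
  have h4 := le_of_mul_le_mul_left h2 (by positivity)
  have h5 : (t * N) ^ 2 ≤ a ^ 2 := by gcongr
  nlinarith

lemma exists_almost_periodic {θ : ℝ} (hθ1 : θ < 1) (i : ℕ) :
    ∀ K > 0, (1 - θ) ^ i * K < 1 → ∀ t > (0 : ℝ), ∃ N₀ : ℕ, ∀ A B : Finset G, N₀ ≤ B.card →
      t * B.card ≤ A.card → (A + B).card ≤ K * B.card →
      ∃ s ≠ 0, ∃ D ⊆ A + B, (∃ a : G, ∀ b ∈ B, a + b ∈ D) ∧
        ((D.filter (· - s ∉ D)).card : ℝ) ≤ θ * D.card := by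
  induction i with
  | zero =>
    intro K hK hK1 t ht
    refine ⟨1, fun A B hB hA hAB ↦ ?_⟩
    have hB0 : (0 : ℝ) < B.card := by exact_mod_cast hB
    have hA0 : A.Nonempty := by
      rw [← Finset.card_pos]
      exact_mod_cast (mul_pos ht hB0).trans_le hA
    have : (B.card : ℝ) ≤ (A + B).card := by
      exact_mod_cast Finset.card_le_card_add_left hA0
    nlinarith
  | succ i ih =>
    intro K hK hK1 t ht
    have hθ' : 0 < 1 - θ := by linarith
    obtain ⟨N₁, hN₁⟩ := ih ((1 - θ) * K) (by positivity) (by rw [pow_succ] at hK1; linarith)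
      (t ^ 2 / (2 * K)) (by positivity)
    obtain ⟨N₂, hN₂⟩ := exists_nat_gt (2 * K / t)
    refine ⟨max (max N₁ N₂) 1, fun A B hB hA hAB ↦ ?_⟩
    have hB1 : N₁ ≤ B.card := by omega
    have hB2 : (N₂ : ℝ) ≤ B.card := by exact_mod_cast (by omega : N₂ ≤ B.card)
    have hB0 : (0 : ℝ) < B.card := by exact_mod_cast (by omega : 0 < B.card)
    obtain ⟨s, hs, hsA⟩ := exists_card_shiftInter_ge hK ht hA
      (by rw [mul_comm t]; exact (div_lt_iff₀ ht).1 (hN₂.trans_le hB2)) hAB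
    have hne : (shiftInter A s).Nonempty := by
      rw [← Finset.card_pos]
      have : 0 < t ^ 2 / (2 * K) * B.card := by positivity
      exact_mod_cast this.trans_le hsA
    by_cases h : ((shiftInter A s + B).card : ℝ) ≤ (1 - θ) * (A + B).card
    · obtain ⟨s', hs', D, hD, h'⟩ := hN₁ (shiftInter A s) B hB1 hsA
        (h.trans (by rw [mul_assoc]; gcongr))
      exact ⟨s', hs', D, hD.trans (Finset.add_subset_add_right (Finset.filter_subset _ _)), h'⟩
    · refine ⟨s, hs, A + B, subset_rfl, ?_, ?_⟩
      · obtain ⟨a, ha⟩ := hne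
        exact ⟨a, fun b hb ↦ Finset.add_mem_add (Finset.mem_filter.1 ha).1 hb⟩
      · have hsub : shiftInter A s + B ⊆ (A + B).filter (· - s ∈ A + B) := by
          intro x hx
          obtain ⟨a, ha, b, hb, rfl⟩ := Finset.mem_add.1 hx
          have ha := Finset.mem_filter.1 ha
          refine Finset.mem_filter.2 ⟨Finset.add_mem_add ha.1 hb, ?_⟩
          rw [add_sub_right_comm]
          exact Finset.add_mem_add ha.2 hb
        have h1 : ((shiftInter A s + B).card : ℝ) ≤ ((A + B).filter (· - s ∈ A + B)).card :=
          Nat.cast_le.2 (Finset.card_le_card hsub)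
        have h2 : (((A + B).filter (· - s ∈ A + B)).card : ℝ) +
            ((A + B).filter (· - s ∉ A + B)).card = (A + B).card := by
          exact_mod_cast Finset.card_filter_add_card_filter_not _
        linarith

variable {H : Type*} [AddCommGroup H]

lemma exists_sub_notMem [IsAddTorsionFree G] {D : Finset G} {s : G} (hs : s ≠ 0) {q : G →+ H}
    (hq : q s = 0) {d : G} (hd : d ∈ D) : ∃ e ∈ D, q e = q d ∧ e - s ∉ D := by
  by_contra! hcon
  have h (n : ℕ) : d - n • s ∈ D := by
    induction n with
    | zero => simpa using hd
    | succ n ih =>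
      rw [succ_nsmul, ← sub_sub]
      exact hcon _ ih (by simp [hq])
  refine Set.infinite_of_injective_forall_mem (f := fun n : ℕ ↦ d - n • s) ?_ h D.finite_toSet
  intro i j hij
  exact nsmul_injective_of_ne_zero hs (sub_right_injective hij)

lemma card_image_le_card_filter [IsAddTorsionFree G] {D : Finset G} {s : G} (hs : s ≠ 0)
    {q : G →+ H} (hq : q s = 0) : (D.image q).card ≤ (D.filter (· - s ∉ D)).card := by
  refine (Finset.card_le_card fun c hc ↦ ?_).trans (Finset.card_image_le (f := q))
  obtain ⟨d, hd, rfl⟩ := Finset.mem_image.1 hc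
  obtain ⟨e, he, heq, hes⟩ := exists_sub_notMem hs hq hd
  exact Finset.mem_image.2 ⟨e, Finset.mem_filter.2 ⟨he, hes⟩, heq⟩

lemma card_image_mul_card_fiber_le (A B : Finset G) (q : G →+ H) (c : H) :
    (A.image q).card * (B.filter (q · = c)).card ≤ (A + B).card := by
  choose! r hr using fun z (hz : z ∈ A.image q) ↦ Finset.mem_image.1 hz
  rw [← Finset.card_product]
  refine Finset.card_le_card_of_injOn (fun x ↦ r x.1 + x.2) ?_ ?_
  · intro x hx
    simp only [Finset.coe_product, Set.mem_prod, Finset.mem_coe, Finset.mem_filter] at hx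
    exact Finset.add_mem_add (hr _ hx.1).1 hx.2.1
  · intro x hx y hy hxy
    simp only [Finset.coe_product, Set.mem_prod, Finset.mem_coe, Finset.mem_filter] at hx hy
    have h1 := congrArg q hxy
    simp only [map_add, hx.2.2, hy.2.2, (hr _ hx.1).2, (hr _ hy.1).2] at h1
    have h2 := add_right_cancel h1
    simp only [h2] at hxy
    exact Prod.ext h2 (add_left_cancel hxy)

lemma exists_card_le_card_image_mul {B : Finset G} (hB : B.Nonempty) (q : G →+ H) :
    ∃ c, B.card ≤ (B.image q).card * (B.filter (q · = c)).card := by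
  by_contra! hcon
  have h1 := Finset.card_eq_sum_card_image q B
  have hpos := Finset.card_pos.2 (hB.image q)
  have h2 : ∑ c ∈ B.image q, (B.image q).card * (B.filter (q · = c)).card <
      ∑ c ∈ B.image q, B.card :=
    Finset.sum_lt_sum_of_nonempty (hB.image q) fun c _ ↦ hcon c
  rw [← Finset.mul_sum, ← h1, Finset.sum_const, smul_eq_mul] at h2
  exact lt_irrefl _ h2

/-- Two large finite sets of the same size with a small sumset are covered, up to an arbitrarily
small proportion, by few translates of a line in a common direction. -/
theorem exists_rich_direction [IsAddTorsionFree G] {K η : ℝ} (hK : 1 ≤ K) (hη : 0 < η)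
    (hη1 : η < 1) : ∃ N₀ : ℕ, ∀ A B : Finset G, N₀ ≤ A.card → A.card = B.card →
      (A + B).card ≤ K * A.card →
      ∃ s : G, s ≠ 0 ∧ ∀ (q : G →+ G), q s = 0 →
        ((A.image q).card : ℝ) ≤ η * A.card ∧ ((B.image q).card : ℝ) ≤ η * A.card := by
  have hK0 : 0 < K := by linarith
  set θ := η / K ^ 2
  have hθ : 0 < θ := by positivity
  have hθ1 : θ < 1 := by
    rw [div_lt_one (by positivity)]
    nlinarith
  obtain ⟨i, hi⟩ := exists_pow_lt_of_lt_one (inv_pos.2 hK0) (by linarith : 1 - θ < 1)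
  obtain ⟨N₀, h⟩ := exists_almost_periodic (G := G) hθ1 i K hK0
    (by rwa [← lt_div_iff₀ hK0, one_div]) 1 one_pos
  refine ⟨max N₀ 1, fun A B hA hAB hsum ↦ ?_⟩
  obtain ⟨s, hs, D, hD, ⟨a, ha⟩, hDs⟩ :=
    h A B (by omega) (by rw [hAB, one_mul]) (by rwa [← hAB])
  refine ⟨s, hs, fun q hq ↦ ?_⟩
  have hBne : B.Nonempty := Finset.card_pos.1 (by omega)
  have hN : (0 : ℝ) < A.card := by exact_mod_cast (by omega : 0 < A.card)
  have hBD : (B.image q).card ≤ (D.image q).card := by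
    refine Finset.card_le_card_of_injOn (fun z ↦ q a + z) ?_ fun _ _ _ _ h ↦ add_left_cancel h
    intro z hz
    obtain ⟨b, hb, rfl⟩ := Finset.mem_image.1 hz
    exact Finset.mem_coe.2 (Finset.mem_image.2 ⟨a + b, ha b hb, map_add q a b⟩)
  have hB : ((B.image q).card : ℝ) ≤ θ * (K * A.card) := by
    have h1 : ((B.image q).card : ℝ) ≤ (D.filter (· - s ∉ D)).card := by
      exact_mod_cast hBD.trans (card_image_le_card_filter hs hq)
    have h2 : (D.card : ℝ) ≤ (A + B).card := by exact_mod_cast Finset.card_le_card hD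
    exact h1.trans (hDs.trans (by gcongr; exact h2.trans hsum))
  have hθK : θ * (K * A.card) * K = η * A.card := by
    simp only [θ]
    field_simp
  have hpos : 0 ≤ θ * (K * A.card) := by positivity
  refine ⟨?_, by nlinarith⟩
  obtain ⟨c, hc⟩ := exists_card_le_card_image_mul hBne q
  have h1 : ((A.image q).card : ℝ) * A.card ≤ (B.image q).card * (K * A.card) := by
    have h2 : (A.image q).card * B.card ≤ (B.image q).card * (A + B).card :=
      (Nat.mul_le_mul_left _ hc).trans (by
        rw [Nat.mul_left_comm]
        exact Nat.mul_le_mul_left _ (card_image_mul_card_fiber_le A B q c))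
    rw [← hAB] at h2
    have h3 : ((A.image q).card : ℝ) * A.card ≤ (B.image q).card * (A + B).card := by
      exact_mod_cast h2
    exact h3.trans (by gcongr)
  rw [← mul_assoc] at h1
  have h2 := le_of_mul_le_mul_right h1 hN
  nlinarith

end RichDirection

section Lattice

/-- The lattice `ℤ × ℤ × ℤⁿ`; its first coordinate is the height. -/
abbrev Lat (n : ℕ) := ℤ × ℤ × (Fin n → ℤ)

variable {n : ℕ}

/-- The point with the given second coordinate and with all other coordinates zero. -/
def axisPt (x : ℤ) : Lat n := (0, x, 0)

/-- The unit vector of the side coordinate `j`. -/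
def sidePt (j : Fin n) : Lat n := (0, 0, Pi.single j 1)

/-- The second coordinate. -/
def axisCoord : Lat n →+ ℤ := AddMonoidHom.mk' (fun x ↦ x.2.1) fun _ _ ↦ rfl

/-- The side coordinate `j`. -/
def sideCoord (j : Fin n) : Lat n →+ ℤ := AddMonoidHom.mk' (fun x ↦ x.2.2 j) fun _ _ ↦ rfl

/-- The weight whose total the compressions decrease. -/
def weight (M : ℤ) : Lat n →+ ℤ :=
  AddMonoidHom.mk' (fun x ↦ x.1 + x.2.1 + M * ∑ j, x.2.2 j) fun x y ↦ by
    simp only [Prod.fst_add, Prod.snd_add, Pi.add_apply, Finset.sum_add_distrib]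
    ring

lemma axisCoord_apply (x : Lat n) : axisCoord x = x.2.1 := rfl

lemma sideCoord_apply (j : Fin n) (x : Lat n) : sideCoord j x = x.2.2 j := rfl

lemma weight_apply (M : ℤ) (x : Lat n) : weight M x = x.1 + x.2.1 + M * ∑ j, x.2.2 j := rfl

/-- A finite set of nonnegative lattice points which contains the origin and is closed under
decreasing the height. -/
structure IsTower (A : Finset (Lat n)) : Prop where
  nonneg : ∀ a ∈ A, 0 ≤ a
  zero_mem : 0 ∈ A
  sub_mem : ∀ a ∈ A, 1 ≤ a.1 → a - (1, 0, 0) ∈ A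

/-- The points of height zero. -/
def base (A : Finset (Lat n)) : Finset (Lat n) := A.filter (·.1 = 0)

/-- A direction `f` with an integral coordinate `k` along which towers can be compressed. -/
structure IsMove (k : Lat n →+ ℤ) (f : Lat n) : Prop where
  coord_self : k f = 1
  fst_eq : f.1 = 0
  coord_height : k (1, 0, 0) = 0
  coord_nonneg : ∀ a, 0 ≤ a → 0 ≤ k a
  sub_nonneg : ∀ a, 0 ≤ a → ∀ m : ℤ, 0 ≤ m → m ≤ k a → 0 ≤ a - m • f

lemma isMove_axis : IsMove (n := n) axisCoord (axisPt 1) where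
  coord_self := rfl
  fst_eq := rfl
  coord_height := rfl
  coord_nonneg a ha := ha.2.1
  sub_nonneg a ha m _ hm' := by
    rw [axisCoord_apply] at hm'
    refine ⟨?_, ?_, fun i ↦ ?_⟩
    · simpa [axisPt] using ha.1
    · simpa [axisPt] using hm'
    · simpa [axisPt] using ha.2.2 i

lemma isMove_side (j : Fin n) (r : ℕ) : IsMove (sideCoord j) (sidePt j - axisPt r) where
  coord_self := by simp [sideCoord_apply, sidePt, axisPt]
  fst_eq := rfl
  coord_height := rfl
  coord_nonneg a ha := ha.2.2 j
  sub_nonneg a ha m hm hm' := by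
    rw [sideCoord_apply] at hm'
    refine ⟨?_, ?_, fun i ↦ ?_⟩
    · simpa [axisPt, sidePt] using ha.1
    · have : 0 ≤ a.2.1 := ha.2.1
      have : 0 ≤ m * r := by positivity
      simp only [axisPt, sidePt, Prod.fst_zero, Prod.snd_zero, Prod.fst_sub, Prod.snd_sub,
        Prod.smul_fst, Prod.smul_snd, smul_eq_mul]
      linarith
    · have : 0 ≤ a.2.2 i := ha.2.2 i
      rcases eq_or_ne i j with rfl | hij
      · simpa [axisPt, sidePt] using hm'
      · simpa [axisPt, sidePt, hij] using this

namespace IsMove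

variable {k : Lat n →+ ℤ} {f : Lat n} {A B : Finset (Lat n)} (h : IsMove k f)
include h

lemma projAlong_fst (a : Lat n) : (projAlong k f a).1 = a.1 := by
  simp [projAlong_apply, h.fst_eq]

lemma isTower_compress (hA : IsTower A) : IsTower (compress (projAlong k f) f A) where
  nonneg x hx := by
    rw [← image_slide h.coord_self] at hx
    obtain ⟨a, ha, rfl⟩ := Finset.mem_image.1 hx
    rw [slide_eq]
    refine h.sub_nonneg a (hA.nonneg a ha) _ (_root_.sub_nonneg.2 ?_) (by omega)
    exact card_below_le (fun a ha ↦ h.coord_nonneg a (hA.nonneg a ha)) ha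
  zero_mem := mem_compress_of_fixed (projAlong_projAlong h.coord_self)
    (projAlong_self h.coord_self) hA.zero_mem (map_zero _)
  sub_mem := compress_sub_mem (projAlong_projAlong h.coord_self) (projAlong_self h.coord_self) _
    (fun a ↦ by rw [h.projAlong_fst]) (by simp [projAlong_apply, h.coord_height]) hA.sub_mem

lemma card_compress : (compress (projAlong k f) f A).card = A.card :=
  SumsetLines.card_compress (projAlong_projAlong h.coord_self) (projAlong_self h.coord_self)
    (ne_zero_of_coord h.coord_self)

lemma card_base_compress : (base (compress (projAlong k f) f A)).card = (base A).card := by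
  rw [base, ← compress_filter (projAlong_projAlong h.coord_self) (projAlong_self h.coord_self) _
    fun a ↦ by rw [h.projAlong_fst]]
  exact h.card_compress

lemma card_compress_add_le : (compress (projAlong k f) f A + compress (projAlong k f) f B).card ≤
    (A + B).card :=
  SumsetLines.card_compress_add_le (projAlong_projAlong h.coord_self)
    (projAlong_self h.coord_self) (ne_zero_of_coord h.coord_self)

lemma mem_compress_of_coord_eq_zero {a : Lat n} (ha : a ∈ A) (hk : k a = 0) :
    a ∈ compress (projAlong k f) f A :=
  mem_compress_of_fixed (projAlong_projAlong h.coord_self) (projAlong_self h.coord_self) ha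
    (by simp [projAlong_apply, hk])

lemma mem_compress_of_sub_mem {a : Lat n} (ha : a ∈ A) (hk : k a = 1) (hs : a - f ∈ A) :
    a ∈ compress (projAlong k f) f A := by
  have := add_mem_compress (projAlong_projAlong h.coord_self) (projAlong_self h.coord_self) hs ha
    (by simpa using ne_zero_of_coord h.coord_self)
    (by simp [projAlong_self h.coord_self]) (by simp [projAlong_apply, hk, h.coord_self])
  simpa using this

end IsMove

/-- Two towers, with a point one step along the axis in the first, that are spanning in all side
directions. -/
structure IsSpanningPair (A B : Finset (Lat n)) : Prop where
  left : IsTower A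
  right : IsTower B
  axis_mem : axisPt 1 ∈ A
  side_mem : ∀ j, sidePt j ∈ A ∨ sidePt j ∈ B ∧ axisPt 1 ∈ B

/-- The side moves that keep a pair of towers spanning. -/
def IsAllowed (A B : Finset (Lat n)) (j : Fin n) (r : ℕ) : Prop :=
  sidePt j ∈ A ∧ axisPt r ∈ A ∨ sidePt j ∈ B ∧ axisPt r ∈ B ∧ axisPt 1 ∈ B

/-- The pair is fixed by the compression along `f`. -/
def IsClosedUnder (k : Lat n →+ ℤ) (f : Lat n) (A B : Finset (Lat n)) : Prop :=
  (∀ a ∈ A, 1 ≤ k a → a - f ∈ A) ∧ ∀ b ∈ B, 1 ≤ k b → b - f ∈ B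

/-- The pair is fixed by the compression along the axis and by all allowed side moves. -/
structure IsStable (M : ℕ) (A B : Finset (Lat n)) : Prop where
  axis : IsClosedUnder axisCoord (axisPt 1) A B
  side : ∀ j, ∀ r < M, IsAllowed A B j r → IsClosedUnder (sideCoord j) (sidePt j - axisPt r) A B

variable {A B : Finset (Lat n)}

lemma IsSpanningPair.compress_axis (h : IsSpanningPair A B) :
    IsSpanningPair (compress (projAlong axisCoord (axisPt 1)) (axisPt 1) A)
      (compress (projAlong axisCoord (axisPt 1)) (axisPt 1) B) where
  left := isMove_axis.isTower_compress h.left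
  right := isMove_axis.isTower_compress h.right
  axis_mem := isMove_axis.mem_compress_of_sub_mem h.axis_mem rfl (by simpa using h.left.zero_mem)
  side_mem j := (h.side_mem j).imp (isMove_axis.mem_compress_of_coord_eq_zero · rfl) fun hj ↦
    ⟨isMove_axis.mem_compress_of_coord_eq_zero hj.1 rfl,
      isMove_axis.mem_compress_of_sub_mem hj.2 rfl (by simpa using h.right.zero_mem)⟩

lemma IsSpanningPair.compress_side (h : IsSpanningPair A B) {j : Fin n} {r : ℕ}
    (hjr : IsAllowed A B j r) :
    IsSpanningPair (compress (projAlong (sideCoord j) (sidePt j - axisPt r))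
        (sidePt j - axisPt r) A)
      (compress (projAlong (sideCoord j) (sidePt j - axisPt r)) (sidePt j - axisPt r) B) where
  left := (isMove_side j r).isTower_compress h.left
  right := (isMove_side j r).isTower_compress h.right
  axis_mem := (isMove_side j r).mem_compress_of_coord_eq_zero h.axis_mem rfl
  side_mem i := by
    have hm := isMove_side j r
    rcases eq_or_ne i j with rfl | hij
    · have h1 : sideCoord i (sidePt i) = 1 := by simp [sideCoord_apply, sidePt]
      exact hjr.imp (fun hi ↦ hm.mem_compress_of_sub_mem hi.1 h1 (by simpa using hi.2)) fun hi ↦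
        ⟨hm.mem_compress_of_sub_mem hi.1 h1 (by simpa using hi.2.1),
          hm.mem_compress_of_coord_eq_zero hi.2.2 rfl⟩
    · have h0 : sideCoord j (sidePt i) = 0 := by simp [sideCoord_apply, sidePt, hij.symm]
      exact (h.side_mem i).imp (hm.mem_compress_of_coord_eq_zero · h0) fun hi ↦
        ⟨hm.mem_compress_of_coord_eq_zero hi.1 h0, hm.mem_compress_of_coord_eq_zero hi.2 rfl⟩

/-- The total weight of a pair. -/
def totalWeight (M : ℤ) (A B : Finset (Lat n)) : ℤ := ∑ a ∈ A, weight M a + ∑ b ∈ B, weight M b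

lemma totalWeight_nonneg {M : ℤ} (hM : 0 ≤ M) (hA : IsTower A) (hB : IsTower B) :
    0 ≤ totalWeight M A B := by
  have h (a : Lat n) (ha : 0 ≤ a) : 0 ≤ weight M a :=
    add_nonneg (add_nonneg ha.1 ha.2.1) (mul_nonneg hM (Finset.sum_nonneg fun j _ ↦ ha.2.2 j))
  exact add_nonneg (Finset.sum_nonneg fun a ha ↦ h a (hA.nonneg a ha))
    (Finset.sum_nonneg fun a ha ↦ h a (hB.nonneg a ha))

lemma IsMove.totalWeight_compress_lt {k : Lat n →+ ℤ} {f : Lat n} (h : IsMove k f) {M : ℤ}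
    (hA : IsTower A) (hB : IsTower B) (hw : 0 < weight M f) (hAB : ¬ IsClosedUnder k f A B) :
    totalWeight M (compress (projAlong k f) f A) (compress (projAlong k f) f B) <
      totalWeight M A B := by
  have hA' a ha := h.coord_nonneg a (hA.nonneg a ha)
  have hB' a ha := h.coord_nonneg a (hB.nonneg a ha)
  simp only [IsClosedUnder, not_and_or, not_forall] at hAB
  rcases hAB with ⟨a, ha, h1, hf⟩ | ⟨a, ha, h1, hf⟩
  · exact add_lt_add_of_lt_of_le (sum_compress_lt h.coord_self hA' hw ha h1 hf)
      (sum_compress_le h.coord_self hB' hw)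
  · exact add_lt_add_of_le_of_lt (sum_compress_le h.coord_self hA' hw)
      (sum_compress_lt h.coord_self hB' hw ha h1 hf)

lemma IsSpanningPair.exists_isStable (M : ℕ) (h : IsSpanningPair A B) :
    ∃ A' B' : Finset (Lat n), IsSpanningPair A' B' ∧ IsStable M A' B' ∧ A'.card = A.card ∧
      B'.card = B.card ∧ (base A').card = (base A).card ∧ (base B').card = (base B).card ∧
      (A' + B').card ≤ (A + B).card := by
  induction hN : (totalWeight M A B).toNat using Nat.strong_induction_on generalizing A B with
  | _ N ih =>
    have key {k : Lat n →+ ℤ} {f : Lat n} (hm : IsMove k f) (hw : 0 < weight M f)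
        (hc : ¬ IsClosedUnder k f A B) (hs : IsSpanningPair (compress (projAlong k f) f A)
          (compress (projAlong k f) f B)) :
        ∃ A' B' : Finset (Lat n), IsSpanningPair A' B' ∧ IsStable M A' B' ∧ A'.card = A.card ∧
          B'.card = B.card ∧ (base A').card = (base A).card ∧ (base B').card = (base B).card ∧
          (A' + B').card ≤ (A + B).card := by
      have hlt := hm.totalWeight_compress_lt h.left h.right hw hc
      have h0 := totalWeight_nonneg (M := M) (by positivity) hs.left hs.right
      obtain ⟨A', B', h1, h2, h3, h4, h5, h6, h7⟩ := ih _ (by omega) hs rfl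
      exact ⟨A', B', h1, h2, h3.trans hm.card_compress, h4.trans hm.card_compress,
        h5.trans hm.card_base_compress, h6.trans hm.card_base_compress,
        h7.trans hm.card_compress_add_le⟩
    by_cases h1 : IsClosedUnder axisCoord (axisPt 1) A B
    · by_cases h2 : IsStable M A B
      · exact ⟨A, B, h, h2, rfl, rfl, rfl, rfl, le_rfl⟩
      · have : ∃ j, ∃ r < M, IsAllowed A B j r ∧
            ¬ IsClosedUnder (sideCoord j) (sidePt j - axisPt r) A B := by
          by_contra! hcon
          exact h2 ⟨h1, hcon⟩
        obtain ⟨j, r, hr, hjr, hc⟩ := this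
        refine key (isMove_side j r) ?_ hc (h.compress_side hjr)
        simp [weight_apply, sidePt, axisPt, hr]
    · exact key isMove_axis (by simp [weight_apply, axisPt]) h1 h.compress_axis

end Lattice

section Shape

variable {n : ℕ} {A B : Finset (Lat n)}

lemma IsTower.mem_of_le (hA : IsTower A)
    (hax : ∀ a ∈ A, 1 ≤ axisCoord a → a - axisPt 1 ∈ A)
    (hside : ∀ j, ∀ a ∈ A, 1 ≤ sideCoord j a → a - sidePt j ∈ A) {a b : Lat n} (ha : a ∈ A)
    (hb : 0 ≤ b) (hba : b ≤ a) : b ∈ A := by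
  induction hN : (weight 1 (a - b)).toNat using Nat.strong_induction_on generalizing a with
  | _ N ih =>
    by_cases hsub : ∃ f : Lat n, 0 < weight 1 f ∧ a - f ∈ A ∧ b ≤ a - f
    · obtain ⟨f, hf, haf, hbf⟩ := hsub
      refine ih _ ?_ haf hbf rfl
      have h0 : 0 ≤ weight 1 (a - f - b) := by
        have h := _root_.sub_nonneg.2 hbf
        have := Finset.sum_nonneg fun j (_ : j ∈ Finset.univ) ↦ h.2.2 j
        exact add_nonneg (add_nonneg h.1 h.2.1) (by simpa using this)
      have h1 : weight 1 (a - f - b) = weight 1 (a - b) - weight 1 f := by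
        rw [← map_sub]
        congr 1
        abel
      omega
    · push Not at hsub
      have hb1 : 0 ≤ b.1 := hb.1
      have hb2 : 0 ≤ b.2.1 := hb.2.1
      have hba1 : b.1 ≤ a.1 := hba.1
      have hba2 : b.2.1 ≤ a.2.1 := hba.2.1
      have h1 : b.1 = a.1 := by
        by_contra hne
        refine hsub (1, 0, 0) (by simp [weight_apply]) (hA.sub_mem a ha (by omega))
          ⟨?_, ?_, fun i ↦ ?_⟩
        · simp only [Prod.fst_sub]; omega
        · simpa using hba2
        · simpa using hba.2.2 i
      have h2 : b.2.1 = a.2.1 := by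
        by_contra hne
        refine hsub (axisPt 1) (by simp [weight_apply, axisPt])
          (hax a ha (by rw [axisCoord_apply]; omega)) ⟨?_, ?_, fun i ↦ ?_⟩
        · simpa [axisPt] using hba1
        · simp only [axisPt, Prod.snd_sub, Prod.fst_sub]; omega
        · simpa [axisPt] using hba.2.2 i
      have h3 (j) : b.2.2 j = a.2.2 j := by
        by_contra hne
        have hbj : 0 ≤ b.2.2 j := hb.2.2 j
        have hbaj : b.2.2 j ≤ a.2.2 j := hba.2.2 j
        refine hsub (sidePt j) (by simp [weight_apply, sidePt])
          (hside j a ha (by rw [sideCoord_apply]; omega)) ⟨?_, ?_, fun i ↦ ?_⟩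
        · simpa [sidePt] using hba1
        · simpa [sidePt] using hba2
        · rcases eq_or_ne i j with rfl | hij
          · simp only [sidePt, Prod.snd_sub, Pi.sub_apply, Pi.single_eq_same]; omega
          · simpa [sidePt, hij] using hba.2.2 i
      have : b = a := Prod.ext h1 (Prod.ext h2 (funext h3))
      exact this ▸ ha

/-- The base of `A` is a segment of the axis together with some of the unit vectors of the side
coordinates. -/
structure IsStar (A : Finset (Lat n)) (K : ℕ) : Prop where
  axis_mem : ∀ x : ℕ, x ≤ K → axisPt x ∈ A
  snd_eq : ∀ a ∈ A, (∃ x : ℕ, x ≤ K ∧ a.2 = ((x : ℤ), 0)) ∨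
    ∃ j, sidePt j ∈ A ∧ a.2 = (0, Pi.single j 1)

lemma IsTower.exists_axis (hA : IsTower A) :
    ∃ K : ℕ, axisPt K ∈ A ∧ ∀ x : ℤ, axisPt x ∈ A → x ≤ K := by
  have hne : (A.filter fun a ↦ axisPt a.2.1 = a).Nonempty :=
    ⟨0, Finset.mem_filter.2 ⟨hA.zero_mem, rfl⟩⟩
  obtain ⟨a, ha, hmax⟩ := Finset.exists_max_image _ (fun a : Lat n ↦ a.2.1) hne
  rw [Finset.mem_filter] at ha
  have h0 : 0 ≤ a.2.1 := (hA.nonneg a ha.1).2.1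
  refine ⟨a.2.1.toNat, by rw [Int.toNat_of_nonneg h0, ha.2]; exact ha.1, fun x hx ↦ ?_⟩
  rw [Int.toNat_of_nonneg h0]
  exact hmax (axisPt x) (Finset.mem_filter.2 ⟨hx, rfl⟩)

lemma IsTower.isStar (hA : IsTower A) {K : ℕ} (hK : axisPt K ∈ A)
    (hmax : ∀ x : ℤ, axisPt x ∈ A → x ≤ K)
    (hax : ∀ a ∈ A, 1 ≤ axisCoord a → a - axisPt 1 ∈ A)
    (hside : ∀ j, ∀ a ∈ A, 1 ≤ sideCoord j a → a - sidePt j ∈ A)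
    (hK1 : ∀ j, sidePt j ∈ A → 1 ≤ K)
    (hsideK : ∀ j, sidePt j ∈ A → ∀ a ∈ A, 1 ≤ sideCoord j a → a - (sidePt j - axisPt K) ∈ A) :
    IsStar A K := by
  have hle {a b : Lat n} (ha : a ∈ A) (hb : 0 ≤ b) (hba : b ≤ a) : b ∈ A :=
    hA.mem_of_le hax hside ha hb hba
  have hsp (j : Fin n) : (0 : Lat n) ≤ sidePt j := ⟨le_rfl, le_rfl, by simp [sidePt]⟩
  have hap (x : ℕ) : (0 : Lat n) ≤ axisPt x := ⟨le_rfl, by simp [axisPt], le_rfl⟩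
  have hj1 (j : Fin n) (b : Lat n) (hb : 0 ≤ b) : 1 ≤ sideCoord j (sidePt j + b) := by
    have : 0 ≤ b.2.2 j := hb.2.2 j
    simpa [sideCoord_apply, sidePt] using this
  have hmem {j : Fin n} {a : Lat n} (ha : a ∈ A) (hj : 1 ≤ a.2.2 j) : sidePt j ∈ A := by
    refine hle ha (hsp j) ⟨(hA.nonneg a ha).1, (hA.nonneg a ha).2.1, fun i ↦ ?_⟩
    rcases eq_or_ne i j with rfl | hij
    · simpa [sidePt] using hj
    · simpa [sidePt, hij] using (hA.nonneg a ha).2.2 i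
  have hno1 (j : Fin n) : sidePt j + axisPt (1 : ℕ) ∉ A := by
    intro h
    have h' := hle h (hsp j) (le_add_of_nonneg_right (hap 1))
    have h2 := hsideK j h' _ h (hj1 j _ (hap 1))
    have h3 := hmax (1 + K) (by convert h2 using 1; simp [axisPt, sidePt])
    omega
  have hno2 (i j : Fin n) : sidePt i + sidePt j ∉ A := by
    intro h
    have hi := hle h (hsp i) (le_add_of_nonneg_right (hsp j))
    have h2 := hsideK i hi _ h (hj1 i _ (hsp j))
    refine hno1 j (hle h2 (add_nonneg (hsp j) (hap 1)) ?_)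
    have : sidePt i + sidePt j - (sidePt i - axisPt K) = sidePt j + axisPt (K : ℤ) := by abel
    rw [this]
    have h1K : (axisPt ((1 : ℕ) : ℤ) : Lat n) ≤ axisPt K :=
      ⟨le_rfl, by simpa [axisPt] using hK1 i hi, le_rfl⟩
    gcongr
  refine ⟨fun x hx ↦ hle hK (hap x) ⟨le_rfl, by simpa [axisPt] using hx, le_rfl⟩, fun a ha ↦ ?_⟩
  have hpos := hA.nonneg a ha
  by_cases hv : ∃ j, 1 ≤ a.2.2 j
  · obtain ⟨j, hj⟩ := hv
    refine .inr ⟨j, hmem ha hj, Prod.ext ?_ (funext fun i ↦ ?_)⟩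
    · by_contra hne
      refine hno1 j (hle ha (add_nonneg (hsp j) (hap 1)) ⟨?_, ?_, fun i ↦ ?_⟩)
      · simpa [sidePt, axisPt] using hpos.1
      · have : 0 ≤ a.2.1 := hpos.2.1
        simp only [sidePt, axisPt, Prod.snd_add, Prod.fst_add] at hne ⊢
        omega
      · have : 0 ≤ a.2.2 i := hpos.2.2 i
        rcases eq_or_ne i j with rfl | hij
        · simpa [sidePt, axisPt] using hj
        · simpa [sidePt, axisPt, hij] using this
    · by_contra hne
      refine hno2 j i (hle ha (add_nonneg (hsp j) (hsp i)) ⟨?_, ?_, fun l ↦ ?_⟩)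
      · simpa [sidePt] using hpos.1
      · simpa [sidePt] using hpos.2.1
      · have hl : 0 ≤ a.2.2 l := hpos.2.2 l
        have hi : 0 ≤ a.2.2 i := hpos.2.2 i
        simp only [sidePt, Prod.snd_add, Pi.add_apply, Pi.single_apply] at hne ⊢
        by_cases h1 : l = j
        · by_cases h2 : l = i
          · subst h1 h2
            simp only [if_true] at hne ⊢
            omega
          · subst h1
            simpa [h2] using hj
        · by_cases h2 : l = i
          · subst h2
            simp only [h1, if_false, if_true] at hne ⊢
            omega
          · simpa [h1, h2] using hl
  · push Not at hv
    have hv0 : a.2.2 = 0 := funext fun j ↦ by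
      have := hv j
      have : 0 ≤ a.2.2 j := hpos.2.2 j
      simp only [Pi.zero_apply]
      omega
    have h0 : 0 ≤ a.2.1 := hpos.2.1
    have hmem : axisPt a.2.1 ∈ A :=
      hle ha ⟨le_rfl, h0, le_rfl⟩ ⟨hpos.1, le_rfl, hpos.2.2⟩
    have := hmax _ hmem
    exact .inl ⟨a.2.1.toNat, by omega, Prod.ext (Int.toNat_of_nonneg h0).symm hv0⟩

lemma lt_of_axisPt_mem {K M : ℕ} (hK : axisPt K ∈ A)
    (hax : ∀ a ∈ A, 1 ≤ axisCoord a → a - axisPt 1 ∈ A) (hM : A.card ≤ M) : K < M := by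
  have h (x : ℕ) : x ≤ K → axisPt (K - x : ℤ) ∈ A := by
    induction x with
    | zero => simpa using hK
    | succ x ih =>
      intro hx
      have := hax _ (ih (by omega)) (by simp only [axisCoord_apply, axisPt]; omega)
      convert this using 1
      simp [axisPt, sub_sub]
  have h2 : (Finset.range (K + 1)).card ≤ A.card := by
    refine Finset.card_le_card_of_injOn (fun x ↦ axisPt (K - x : ℤ)) ?_ ?_
    · intro x hx
      exact h x (by simpa [Nat.lt_succ_iff] using hx)
    · intro x _ y _ hxy
      simpa [axisPt] using hxy
  rw [Finset.card_range] at h2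
  omega

theorem IsSpanningPair.exists_isStar (h : IsSpanningPair A B) {M : ℕ} (hM : IsStable M A B)
    (hAM : A.card ≤ M) (hBM : B.card ≤ M) :
    ∃ K L : ℕ, 1 ≤ K ∧ IsStar A K ∧ IsStar B L ∧ (∀ j, sidePt j ∈ A ∨ sidePt j ∈ B) ∧
      ∀ j, sidePt j ∈ A → sidePt j ∈ B → K = L := by
  obtain ⟨K, hK, hKmax⟩ := h.left.exists_axis
  obtain ⟨L, hL, hLmax⟩ := h.right.exists_axis
  have hKM : K < M := lt_of_axisPt_mem hK hM.axis.1 hAM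
  have hLM : L < M := lt_of_axisPt_mem hL hM.axis.2 hBM
  have hK1 : 1 ≤ K := by exact_mod_cast hKmax 1 h.axis_mem
  have h1 (j : Fin n) : 1 ≤ sideCoord j (sidePt j) := by simp [sideCoord_apply, sidePt]
  have h0 (j : Fin n) : IsClosedUnder (sideCoord j) (sidePt j) A B := by
    have : IsAllowed A B j 0 := (h.side_mem j).imp (fun hj ↦ ⟨hj, h.left.zero_mem⟩)
      fun hj ↦ ⟨hj.1, h.right.zero_mem, hj.2⟩
    have := hM.side j 0 (by omega) this
    have h0 : (axisPt ((0 : ℕ) : ℤ) : Lat n) = 0 := rfl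
    rwa [h0, sub_zero] at this
  have hB1 (j : Fin n) (hj : sidePt j ∈ B) : axisPt 1 ∈ B := by
    rcases h.side_mem j with hj' | hj'
    · have := (hM.side j 1 (by omega) (.inl ⟨hj', h.axis_mem⟩)).2 _ hj (h1 j)
      simpa using this
    · exact hj'.2
  have hA' (j : Fin n) (hj : sidePt j ∈ A) := hM.side j K hKM (.inl ⟨hj, hK⟩)
  have hB' (j : Fin n) (hj : sidePt j ∈ B) := hM.side j L hLM (.inr ⟨hj, hL, hB1 j hj⟩)
  refine ⟨K, L, hK1, h.left.isStar hK hKmax hM.axis.1 (fun j ↦ (h0 j).1) (fun _ _ ↦ hK1)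
    fun j hj ↦ (hA' j hj).1, h.right.isStar hL hLmax hM.axis.2 (fun j ↦ (h0 j).2)
    (fun j hj ↦ by exact_mod_cast hLmax 1 (hB1 j hj)) fun j hj ↦ (hB' j hj).2,
    fun j ↦ (h.side_mem j).imp_right And.left, fun j hjA hjB ↦ le_antisymm ?_ ?_⟩
  · have := (hA' j hjA).2 _ hjB (h1 j)
    exact_mod_cast hLmax K (by simpa using this)
  · have := (hB' j hjB).1 _ hjA (h1 j)
    exact_mod_cast hKmax L (by simpa using this)

lemma mem_base {a : Lat n} : a ∈ base A ↔ a ∈ A ∧ a.1 = 0 := Finset.mem_filter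

lemma IsStar.lt_card_base {K : ℕ} (h : IsStar A K) : K < (base A).card := by
  rw [← Nat.succ_le_iff, Nat.succ_eq_add_one, ← Finset.card_range (K + 1)]
  refine Finset.card_le_card_of_injOn (fun x : ℕ ↦ axisPt x) ?_ ?_
  · intro x hx
    exact mem_base.2 ⟨h.axis_mem x (by simpa [Nat.lt_succ_iff] using hx), rfl⟩
  · intro x _ y _ hxy
    simpa [axisPt] using hxy

lemma IsStar.card_base_le {K : ℕ} (h : IsStar A K) : (base A).card ≤ K + 1 + n := by
  have hsub : base A ⊆ (Finset.range (K + 1)).image (fun x : ℕ ↦ axisPt x) ∪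
      Finset.univ.image sidePt := by
    intro a ha
    rw [mem_base] at ha
    rw [Finset.mem_union, Finset.mem_image, Finset.mem_image]
    refine (h.snd_eq a ha.1).imp ?_ ?_
    · rintro ⟨x, hx, hax⟩
      exact ⟨x, by simpa [Nat.lt_succ_iff] using hx, Prod.ext ha.2.symm hax.symm⟩
    · rintro ⟨j, -, haj⟩
      exact ⟨j, Finset.mem_univ _, Prod.ext ha.2.symm haj.symm⟩
  refine (Finset.card_le_card hsub).trans ((Finset.card_union_le _ _).trans ?_)
  refine add_le_add (Finset.card_image_le.trans (Finset.card_range _).le)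
    (Finset.card_image_le.trans ?_)
  simp

end Shape

lemma mul_add_le_sum_range (α β : ℕ → ℝ) (K L : ℕ) (g : ℕ → ℝ)
    (h : ∀ i ≤ K, ∀ j ≤ L, α i + β j ≤ g (i + j)) :
    (K + L + 1) * ((∑ i ∈ Finset.range (K + 1), α i) / (K + 1) +
      (∑ j ∈ Finset.range (L + 1), β j) / (L + 1)) ≤ ∑ k ∈ Finset.range (K + L + 1), g k := by
  induction K generalizing L with
  | zero =>
    have h1 : ∑ j ∈ Finset.range (L + 1), (α 0 + β j) ≤ ∑ k ∈ Finset.range (L + 1), g k :=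
      Finset.sum_le_sum fun j hj ↦ by
        simpa using h 0 le_rfl j (by simpa [Nat.lt_succ_iff] using hj)
    rw [Finset.sum_add_distrib, Finset.sum_const, Finset.card_range, nsmul_eq_mul] at h1
    push_cast at h1
    rw [show 0 + L + 1 = L + 1 by omega]
    refine le_trans (le_of_eq ?_) h1
    simp only [zero_add, Finset.sum_range_one]
    push_cast
    field_simp
    ring
  | succ K ihK =>
    induction L with
    | zero =>
      have h1 : ∑ i ∈ Finset.range (K + 1 + 1), (α i + β 0) ≤
          ∑ k ∈ Finset.range (K + 1 + 1), g k :=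
        Finset.sum_le_sum fun i hi ↦ by
          simpa using h i (by simpa [Nat.lt_succ_iff] using hi) 0 le_rfl
      rw [Finset.sum_add_distrib, Finset.sum_const, Finset.card_range, nsmul_eq_mul] at h1
      push_cast at h1
      rw [add_zero]
      refine le_trans (le_of_eq ?_) h1
      simp only [zero_add, Finset.sum_range_one]
      push_cast
      field_simp
      ring
    | succ L ihL =>
      have h1 := ihK (L + 1) fun i hi j hj ↦ h i (by omega) j hj
      have h2 := ihL fun i hi j hj ↦ h i hi j (by omega)
      have h3 := h (K + 1) le_rfl (L + 1) le_rfl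
      rw [show K + 1 + (L + 1) = K + L + 2 by ring] at h3 ⊢
      rw [show K + (L + 1) + 1 = K + L + 2 by ring] at h1
      rw [show K + 1 + L + 1 = K + L + 2 by ring] at h2
      rw [Finset.sum_range_succ g (K + L + 2)]
      rw [Finset.sum_range_succ α (K + 1)] at h2 ⊢
      rw [Finset.sum_range_succ β (L + 1)] at h1 ⊢
      push_cast at h1 h2 ⊢
      generalize ∑ k ∈ Finset.range (K + L + 2), g k = S at *
      generalize ∑ i ∈ Finset.range (K + 1), α i = a at *
      generalize ∑ j ∈ Finset.range (L + 1), β j = b at *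
      have hK : (0 : ℝ) < K + 1 := by positivity
      have hL : (0 : ℝ) < L + 1 := by positivity
      have hKL : (0 : ℝ) < K + L + 2 := by positivity
      have h4 : (K + 1 : ℝ) * (a / (K + 1) + (b + β (L + 1)) / (L + 1 + 1)) +
          (L + 1) * ((a + α (K + 1)) / (K + 1 + 1) + b / (L + 1)) ≤ S := by
        refine le_of_mul_le_mul_left ?_ hKL
        have e1 := mul_le_mul_of_nonneg_left h1 hK.le
        have e2 := mul_le_mul_of_nonneg_left h2 hL.le
        linarith
      refine le_trans (le_of_eq ?_) (add_le_add h4 h3)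
      field_simp
      ring

section Weights

variable {n : ℕ}

/-- The weight with which the sum of a side column of one set and the axis columns of the other set
is counted. -/
noncomputable def sideWeight (p q : Fin n → ℝ) (j : Fin n) : ℝ := p j * (1 - q j / 2)

/-- The weight with which the sum of two side columns is counted. -/
noncomputable def pairWeight (p q : Fin n → ℝ) (i j : Fin n) : ℝ :=
  if i = j then p i * q j else p i * q j * (1 - p j * q i / 2)

variable {p q : Fin n → ℝ}

lemma pairWeight_comm (i j : Fin n) : pairWeight p q i j = pairWeight q p j i := by
  rcases eq_or_ne i j with rfl | h
  · simp [pairWeight, mul_comm]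
  · simp [pairWeight, h, h.symm, mul_comm]

lemma pairWeight_nonneg (hp : ∀ j, p j = 0 ∨ p j = 1) (hq : ∀ j, q j = 0 ∨ q j = 1) (i j : Fin n) :
    0 ≤ pairWeight p q i j := by
  rw [pairWeight]
  rcases hp i with h1 | h1 <;> rcases hq j with h2 | h2 <;> rcases hp j with h3 | h3 <;>
    rcases hq i with h4 | h4 <;> rw [h1, h2, h3, h4] <;> norm_num
  split_ifs <;> norm_num

lemma pairWeight_le_one (hp : ∀ j, p j = 0 ∨ p j = 1) (hq : ∀ j, q j = 0 ∨ q j = 1) (i j : Fin n) :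
    pairWeight p q i j ≤ 1 := by
  rw [pairWeight]
  rcases hp i with h1 | h1 <;> rcases hq j with h2 | h2 <;> rcases hp j with h3 | h3 <;>
    rcases hq i with h4 | h4 <;> rw [h1, h2, h3, h4] <;> norm_num
  split_ifs <;> norm_num

lemma pairWeight_add_le_one (hp : ∀ j, p j = 0 ∨ p j = 1) (hq : ∀ j, q j = 0 ∨ q j = 1)
    {i j : Fin n} (hij : i ≠ j) : pairWeight p q i j + pairWeight p q j i ≤ 1 := by
  rw [pairWeight, pairWeight, if_neg hij, if_neg hij.symm]
  rcases hp i with h1 | h1 <;> rcases hq j with h2 | h2 <;> rcases hp j with h3 | h3 <;>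
    rcases hq i with h4 | h4 <;> rw [h1, h2, h3, h4] <;> norm_num

lemma le_sideWeight_add_sum_pairWeight (hp : ∀ j, p j = 0 ∨ p j = 1) (hq : ∀ j, q j = 0 ∨ q j = 1)
    {K L : ℕ} {i : Fin n} (hi : p i = 1) (hKL : q i = 1 → K = L) :
    1 + (L : ℝ) / (K + 1) + ∑ j, sideWeight q p j ≤
      sideWeight p q i * (L + 1) + ∑ j, pairWeight p q i j := by
  have h1 : ∑ j, (sideWeight q p j + if j = i then q j / 2 else 0) ≤ ∑ j, pairWeight p q i j := by
    refine Finset.sum_le_sum fun j _ ↦ ?_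
    rcases eq_or_ne j i with rfl | hij
    · simp only [sideWeight, pairWeight, if_true, hi]
      linarith
    · simp only [sideWeight, pairWeight, if_neg hij, if_neg hij.symm, hi]
      rcases hp j with h3 | h3 <;> rcases hq j with h2 | h2 <;> rcases hq i with h4 | h4 <;>
        rw [h2, h3, h4] <;> norm_num
  rw [Finset.sum_add_distrib, Finset.sum_ite_eq' Finset.univ i, if_pos (Finset.mem_univ i)] at h1
  refine le_trans ?_ (add_le_add_right h1 _)
  rw [show sideWeight p q i = 1 - q i / 2 by rw [sideWeight, hi, one_mul]]
  suffices 1 + (L : ℝ) / (K + 1) ≤ (1 - q i / 2) * (L + 1) + q i / 2 by linarith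
  rcases hq i with h2 | h2
  · have : (L : ℝ) / (K + 1) ≤ L := div_le_self (by positivity) (by simp)
    rw [h2]
    linarith
  · obtain rfl := hKL h2
    rw [h2]
    have : (K : ℝ) / (K + 1) ≤ K / 2 := by
      rcases Nat.eq_zero_or_pos K with rfl | hK
      · simp
      · have : (1 : ℝ) ≤ K := by exact_mod_cast hK
        gcongr
        linarith
    linarith

lemma sum_indicator_le_one {w : Fin n → Fin n → ℝ} (hw : ∀ i, w i i ≤ 1)
    (hw' : ∀ i j, i ≠ j → w i j + w j i ≤ 1) (v : Fin n → ℤ) :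
    (if v = 0 then 1 else 0) + ∑ j, (if v = Pi.single j 1 then 1 else 0) +
      ∑ i, ∑ j, (if v = Pi.single i 1 + Pi.single j 1 then w i j else 0) ≤ 1 := by
  have hs (j : Fin n) : ∑ l, (Pi.single j 1 : Fin n → ℤ) l = 1 := by simp
  have hs2 (i j : Fin n) : ∑ l, (Pi.single i 1 + Pi.single j 1 : Fin n → ℤ) l = 2 := by
    simp [Finset.sum_add_distrib]
  have hS0 (h : ∑ l, v l ≠ 0) : (if v = 0 then (1 : ℝ) else 0) = 0 :=
    if_neg (by rintro rfl; simp at h)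
  have hS1 (h : ∑ l, v l ≠ 1) : ∑ j, (if v = Pi.single j 1 then (1 : ℝ) else 0) = 0 :=
    Finset.sum_eq_zero fun j _ ↦ if_neg (by rintro rfl; exact h (hs j))
  have hS2 (h : ∑ l, v l ≠ 2) :
      ∑ i, ∑ j, (if v = Pi.single i 1 + Pi.single j 1 then w i j else 0) = 0 :=
    Finset.sum_eq_zero fun i _ ↦ Finset.sum_eq_zero fun j _ ↦
      if_neg (by rintro rfl; exact h (hs2 i j))
  by_cases h0 : ∑ l, v l = 0
  · rw [hS1 (by omega), hS2 (by omega)]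
    split_ifs <;> norm_num
  by_cases h1 : ∑ l, v l = 1
  · rw [hS0 (by omega), hS2 (by omega)]
    by_cases hj : ∃ j, v = Pi.single j 1
    · obtain ⟨j, rfl⟩ := hj
      have (i : Fin n) : (Pi.single j 1 : Fin n → ℤ) = Pi.single i 1 ↔ j = i := by
        refine ⟨fun h ↦ ?_, fun h ↦ by rw [h]⟩
        by_contra hij
        have := congrFun h j
        simp [hij] at this
      simp [this]
    · push Not at hj
      simp [hj]
  rw [hS0 h0, hS1 h1, zero_add, zero_add]
  by_cases hij : ∃ i j, v = Pi.single i 1 + Pi.single j 1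
  · obtain ⟨i, j, rfl⟩ := hij
    have hiff (k l : Fin n) : (Pi.single i 1 + Pi.single j 1 : Fin n → ℤ) =
        Pi.single k 1 + Pi.single l 1 ↔ (k, l) ∈ ({(i, j), (j, i)} : Finset (Fin n × Fin n)) := by
      rw [Pi.single_add_single_eq_single_add_single one_ne_zero one_ne_zero]
      simp
      grind
    simp only [hiff]
    rw [← Finset.sum_product' (f := fun k l ↦
      if (k, l) ∈ ({(i, j), (j, i)} : Finset (Fin n × Fin n)) then w k l else 0),
      Finset.univ_product_univ, Finset.sum_ite_mem, Finset.univ_inter]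
    rcases eq_or_ne i j with rfl | hne
    · simpa using hw i
    · rw [Finset.sum_pair (by simpa using fun h ↦ absurd h hne)]
      exact hw' i j hne
  · push Not at hij
    simp [hij]

end Weights

section Columns

variable {n : ℕ} {A B : Finset (Lat n)}

/-- The column of `A` over the point `u`. -/
def column (A : Finset (Lat n)) (u : ℤ × (Fin n → ℤ)) : Finset (Lat n) := A.filter (·.2 = u)

/-- The layer of `A` with side coordinates `v`. -/
def layer (A : Finset (Lat n)) (v : Fin n → ℤ) : Finset (Lat n) := A.filter (·.2.2 = v)

lemma mem_column {a : Lat n} {u : ℤ × (Fin n → ℤ)} : a ∈ column A u ↔ a ∈ A ∧ a.2 = u :=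
  Finset.mem_filter

lemma card_column_add_le {u v : ℤ × (Fin n → ℤ)} (hu : (column A u).Nonempty)
    (hv : (column B v).Nonempty) :
    ((column A u).card : ℝ) + (column B v).card - 1 ≤ (column (A + B) (u + v)).card := by
  have h := cauchy_davenport_of_isAddTorsionFree hu hv
  have hsub : column A u + column B v ⊆ column (A + B) (u + v) := by
    intro z hz
    obtain ⟨x, hx, y, hy, rfl⟩ := Finset.mem_add.1 hz
    rw [mem_column] at hx hy ⊢
    exact ⟨Finset.add_mem_add hx.1 hy.1, by rw [Prod.snd_add, hx.2, hy.2]⟩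
  have h' : (column A u).card + (column B v).card ≤ (column (A + B) (u + v)).card + 1 := by
    have := Finset.card_le_card hsub
    omega
  rw [sub_le_iff_le_add]
  exact_mod_cast h'

lemma card_column_le_card_layer (x : ℤ) (v : Fin n → ℤ) :
    ((column A (x, v)).card : ℝ) ≤ (layer A v).card := by
  refine Nat.cast_le.2 (Finset.card_le_card fun a ha ↦ ?_)
  rw [mem_column] at ha
  exact Finset.mem_filter.2 ⟨ha.1, by rw [ha.2]⟩

lemma sum_card_column_le (m : ℕ) (v : Fin n → ℤ) :
    ∑ k ∈ Finset.range m, ((column A (k, v)).card : ℝ) ≤ (layer A v).card := by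
  rw [← Nat.cast_sum, ← Finset.card_biUnion]
  · refine Nat.cast_le.2 (Finset.card_le_card fun a ha ↦ ?_)
    obtain ⟨k, -, hk⟩ := Finset.mem_biUnion.1 ha
    rw [mem_column] at hk
    exact Finset.mem_filter.2 ⟨hk.1, by rw [hk.2]⟩
  · intro i _ j _ hij
    rw [Function.onFun, Finset.disjoint_left]
    intro a hi hj
    rw [mem_column] at hi hj
    have := hi.2.symm.trans hj.2
    simp only [Prod.mk.injEq, Nat.cast_inj] at this
    exact hij this.1

lemma sum_mul_card_layer_le (C : Finset (Lat n)) {w : Fin n → Fin n → ℝ} (hw : ∀ i, w i i ≤ 1)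
    (hw' : ∀ i j, i ≠ j → w i j + w j i ≤ 1) :
    ((layer C 0).card : ℝ) + ∑ j, ((layer C (Pi.single j 1)).card : ℝ) +
      ∑ i, ∑ j, w i j * (layer C (Pi.single i 1 + Pi.single j 1)).card ≤ C.card := by
  have h := Finset.sum_le_sum fun (z : Lat n) (_ : z ∈ C) ↦ sum_indicator_le_one hw hw' z.2.2
  rw [Finset.sum_add_distrib, Finset.sum_add_distrib, Finset.sum_comm (s := C),
    Finset.sum_comm (s := C)] at h
  simp only [Finset.sum_comm (s := C)] at h
  simpa [layer, ← Finset.sum_filter, mul_comm] using h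

variable {K L : ℕ}

lemma IsStar.column_axis_nonempty (h : IsStar A K) {x : ℕ} (hx : x ≤ K) :
    (column A (x, 0)).Nonempty := ⟨axisPt x, mem_column.2 ⟨h.axis_mem x hx, rfl⟩⟩

lemma column_side_nonempty {j : Fin n} (h : sidePt j ∈ A) :
    (column A (0, Pi.single j 1)).Nonempty := ⟨sidePt j, mem_column.2 ⟨h, rfl⟩⟩

lemma IsStar.card_column_side (h : IsStar A K) {j : Fin n} (hj : sidePt j ∉ A) :
    (column A (0, Pi.single j 1)).card = 0 := by
  rw [Finset.card_eq_zero, Finset.eq_empty_iff_forall_notMem]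
  intro a ha
  rw [mem_column] at ha
  rcases h.snd_eq a ha.1 with ⟨x, -, hx⟩ | ⟨i, hi, hx⟩
  · have := congrFun (congrArg Prod.snd (ha.2.symm.trans hx)) j
    simp at this
  · have := congrFun (congrArg Prod.snd (ha.2.symm.trans hx)) j
    rcases eq_or_ne j i with rfl | hij
    · exact hj hi
    · simp [hij] at this

lemma IsStar.card_le (h : IsStar A K) :
    (A.card : ℝ) ≤ ∑ x ∈ Finset.range (K + 1), ((column A (x, 0)).card : ℝ) +
      ∑ j, ((column A (0, Pi.single j 1)).card : ℝ) := by
  have hsub : A ⊆ (Finset.range (K + 1)).biUnion (fun x : ℕ ↦ column A (x, 0)) ∪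
      Finset.univ.biUnion fun j ↦ column A (0, Pi.single j 1) := by
    intro a ha
    rw [Finset.mem_union, Finset.mem_biUnion, Finset.mem_biUnion]
    refine (h.snd_eq a ha).imp ?_ ?_
    · rintro ⟨x, hx, hax⟩
      exact ⟨x, by simpa [Nat.lt_succ_iff] using hx, mem_column.2 ⟨ha, hax⟩⟩
    · rintro ⟨j, -, haj⟩
      exact ⟨j, Finset.mem_univ _, mem_column.2 ⟨ha, haj⟩⟩
  exact_mod_cast (Finset.card_le_card hsub).trans ((Finset.card_union_le _ _).trans
    (add_le_add Finset.card_biUnion_le Finset.card_biUnion_le))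

lemma IsStar.card_layer_zero_add_ge (hA : IsStar A K) (hB : IsStar B L) :
    ((K : ℝ) + L + 1) * ((∑ x ∈ Finset.range (K + 1), ((column A (x, 0)).card : ℝ)) / (K + 1) +
      (∑ x ∈ Finset.range (L + 1), ((column B (x, 0)).card : ℝ)) / (L + 1)) - (K + L + 1) ≤
      (layer (A + B) 0).card := by
  have h := mul_add_le_sum_range (fun x ↦ (column A (x, 0)).card) (fun x ↦ (column B (x, 0)).card)
    K L (fun x ↦ (column (A + B) (x, 0)).card + 1) fun i hi j hj ↦ by
      have := card_column_add_le (hA.column_axis_nonempty hi) (hB.column_axis_nonempty hj)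
      rw [Prod.mk_add_mk, add_zero] at this
      push_cast
      linarith
  rw [Finset.sum_add_distrib, Finset.sum_const, Finset.card_range, nsmul_one] at h
  have h' := sum_card_column_le (A := A + B) (K + L + 1) 0
  push_cast at h
  linarith

lemma IsStar.card_layer_single_add_ge (hB : IsStar B L) {j : Fin n} (hj : sidePt j ∈ A) :
    ∑ x ∈ Finset.range (L + 1), ((column B (x, 0)).card : ℝ) +
      (L + 1) * ((column A (0, Pi.single j 1)).card - 1) ≤
      (layer (A + B) (Pi.single j 1)).card := by
  refine le_trans ?_ (sum_card_column_le (L + 1) _)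
  have : ∑ x ∈ Finset.range (L + 1),
      (((column B (x, 0)).card : ℝ) + ((column A (0, Pi.single j 1)).card - 1)) ≤
      ∑ x ∈ Finset.range (L + 1), ((column (A + B) (x, Pi.single j 1)).card : ℝ) := by
    refine Finset.sum_le_sum fun x hx ↦ ?_
    have := card_column_add_le (column_side_nonempty hj)
      (hB.column_axis_nonempty (x := x) (by simpa [Nat.lt_succ_iff] using hx))
    rw [Prod.mk_add_mk, add_zero, zero_add] at this
    linarith
  refine le_trans (le_of_eq ?_) this
  rw [Finset.sum_add_distrib, Finset.sum_const, Finset.card_range, nsmul_eq_mul]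
  push_cast
  ring

lemma card_layer_add_single_ge {i j : Fin n} (hi : sidePt i ∈ A) (hj : sidePt j ∈ B) :
    ((column A (0, Pi.single i 1)).card : ℝ) + (column B (0, Pi.single j 1)).card - 1 ≤
      (layer (A + B) (Pi.single i 1 + Pi.single j 1)).card :=
  (card_column_add_le (column_side_nonempty hi) (column_side_nonempty hj)).trans
    (card_column_le_card_layer 0 _)

end Columns

section Counting

variable {n : ℕ} {A B : Finset (Lat n)} {K L : ℕ}

/-- The indicator function of the side directions of `A`. -/
noncomputable def sideIndicator (A : Finset (Lat n)) (j : Fin n) : ℝ :=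
  if sidePt j ∈ A then 1 else 0

lemma sideIndicator_eq (A : Finset (Lat n)) (j : Fin n) :
    sideIndicator A j = 0 ∨ sideIndicator A j = 1 := by
  rw [sideIndicator]
  split_ifs <;> simp

lemma IsStar.card_layer_single_ge (hA : IsStar A K) (hB : IsStar B L) (j : Fin n)
    (hside : sidePt j ∈ A ∨ sidePt j ∈ B) :
    sideWeight (sideIndicator A) (sideIndicator B) j *
        (∑ x ∈ Finset.range (L + 1), ((column B (x, 0)).card : ℝ) +
          (L + 1) * ((column A (0, Pi.single j 1)).card - 1)) +
      sideWeight (sideIndicator B) (sideIndicator A) j *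
        (∑ x ∈ Finset.range (K + 1), ((column A (x, 0)).card : ℝ) +
          (K + 1) * ((column B (0, Pi.single j 1)).card - 1)) ≤
      (layer (A + B) (Pi.single j 1)).card := by
  have h1 := hB.card_layer_single_add_ge (A := A) (j := j)
  have h2 := hA.card_layer_single_add_ge (A := B) (j := j)
  rw [add_comm B A] at h2
  simp only [sideWeight, sideIndicator]
  by_cases hjA : sidePt j ∈ A <;> by_cases hjB : sidePt j ∈ B
  · have := h1 hjA
    have := h2 hjB
    simp only [hjA, hjB, if_true]
    linarith
  · have := h1 hjA
    simp only [hjA, hjB, if_true, if_false]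
    linarith
  · have := h2 hjB
    simp only [hjA, hjB, if_true, if_false]
    linarith
  · exact absurd hside (by tauto)

lemma pairWeight_mul_le (i j : Fin n) :
    pairWeight (sideIndicator A) (sideIndicator B) i j *
        (((column A (0, Pi.single i 1)).card : ℝ) + (column B (0, Pi.single j 1)).card - 1) ≤
      pairWeight (sideIndicator A) (sideIndicator B) i j *
        (layer (A + B) (Pi.single i 1 + Pi.single j 1)).card := by
  by_cases hi : sidePt i ∈ A
  · by_cases hj : sidePt j ∈ B
    · exact mul_le_mul_of_nonneg_left (card_layer_add_single_ge hi hj)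
        (pairWeight_nonneg (sideIndicator_eq A) (sideIndicator_eq B) i j)
    · simp [pairWeight, sideIndicator, hj]
  · simp [pairWeight, sideIndicator, hi]

lemma IsStar.card_column_mul_ge (hA : IsStar A K) (i : Fin n)
    (hKL : sidePt i ∈ A → sidePt i ∈ B → K = L) :
    ((column A (0, Pi.single i 1)).card : ℝ) *
        (1 + L / (K + 1) + ∑ j, sideWeight (sideIndicator B) (sideIndicator A) j) ≤
      (column A (0, Pi.single i 1)).card *
        (sideWeight (sideIndicator A) (sideIndicator B) i * (L + 1) +
          ∑ j, pairWeight (sideIndicator A) (sideIndicator B) i j) := by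
  by_cases hi : sidePt i ∈ A
  · refine mul_le_mul_of_nonneg_left (le_sideWeight_add_sum_pairWeight (sideIndicator_eq A)
      (sideIndicator_eq B) (by simp [sideIndicator, hi]) fun h ↦ hKL hi ?_) (by positivity)
    by_contra hi'
    simp [sideIndicator, hi'] at h
  · simp [hA.card_column_side hi]

/-- The lower bound for the size of the sumset of two towers whose bases are stars. -/
theorem IsStar.card_add_ge (hA : IsStar A K) (hB : IsStar B L) (hAB : A.card = B.card)
    (hside : ∀ j, sidePt j ∈ A ∨ sidePt j ∈ B)
    (hKL : ∀ j, sidePt j ∈ A → sidePt j ∈ B → K = L) :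
    (n + ((K : ℝ) + L + 1) * (1 / (K + 1) + 1 / (L + 1))) * A.card -
      (((K : ℝ) + L + 2) * (n + 1) + n ^ 2) ≤ (A + B).card := by
  set p := sideIndicator A
  set q := sideIndicator B
  have hp : ∀ j, p j = 0 ∨ p j = 1 := sideIndicator_eq A
  have hq : ∀ j, q j = 0 ∨ q j = 1 := sideIndicator_eq B
  set a : ℝ := ∑ x ∈ Finset.range (K + 1), ((column A (x, 0)).card : ℝ)
  set b : ℝ := ∑ x ∈ Finset.range (L + 1), ((column B (x, 0)).card : ℝ)
  set ε : Fin n → ℝ := fun j ↦ (column A (0, Pi.single j 1)).card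
  set δ : Fin n → ℝ := fun j ↦ (column B (0, Pi.single j 1)).card
  set lam := sideWeight p q
  set mu := sideWeight q p
  set w := pairWeight p q
  have hlm (j : Fin n) : lam j + mu j = 1 := by
    have : p j = 1 ∨ q j = 1 := (hside j).imp (if_pos ·) (if_pos ·)
    simp only [lam, mu, sideWeight]
    rcases this with h | h <;> rw [h] <;> ring
  have hlm0 (j : Fin n) : 0 ≤ lam j ∧ 0 ≤ mu j := by
    simp only [lam, mu, sideWeight]
    rcases hp j with h1 | h1 <;> rcases hq j with h2 | h2 <;> rw [h1, h2] <;> norm_num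
  have hlmsum : ∑ j, lam j + ∑ j, mu j = n := by
    rw [← Finset.sum_add_distrib, Finset.sum_congr rfl fun j _ ↦ hlm j]
    simp
  have hl0 : 0 ≤ ∑ j, lam j := Finset.sum_nonneg fun j _ ↦ (hlm0 j).1
  have hm0 : 0 ≤ ∑ j, mu j := Finset.sum_nonneg fun j _ ↦ (hlm0 j).2
  have hw1 : ∑ i, ∑ j, w i j ≤ (n : ℝ) ^ 2 := by
    calc _ ≤ ∑ _i : Fin n, ∑ _j : Fin n, (1 : ℝ) := Finset.sum_le_sum fun i _ ↦
          Finset.sum_le_sum fun j _ ↦ pairWeight_le_one hp hq i j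
      _ = _ := by simp [sq]
  have hcount := sum_mul_card_layer_le (A + B) (w := w) (fun i ↦ pairWeight_le_one hp hq i i)
    fun i j hij ↦ pairWeight_add_le_one hp hq hij
  have h0 := hA.card_layer_zero_add_ge hB
  have h1 := Finset.sum_le_sum fun j (_ : j ∈ Finset.univ) ↦
    hA.card_layer_single_ge hB j (hside j)
  have h2 := Finset.sum_le_sum fun i (_ : i ∈ Finset.univ) ↦
    Finset.sum_le_sum fun j (_ : j ∈ Finset.univ) ↦ pairWeight_mul_le (A := A) (B := B) i j
  have h3 := Finset.sum_le_sum fun i (_ : i ∈ Finset.univ) ↦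
    hA.card_column_mul_ge (L := L) i (hKL i)
  have h4 := Finset.sum_le_sum fun i (_ : i ∈ Finset.univ) ↦
    hB.card_column_mul_ge (L := K) i fun hiB hiA ↦ (hKL i hiA hiB).symm
  have e1 : ∑ j, (lam j * (b + (L + 1) * (ε j - 1)) + mu j * (a + (K + 1) * (δ j - 1))) =
      (∑ j, lam j) * (b - (L + 1)) + (∑ j, mu j) * (a - (K + 1)) +
      ∑ j, ε j * (lam j * (L + 1)) + ∑ j, δ j * (mu j * (K + 1)) := by
    rw [Finset.sum_mul, Finset.sum_mul, ← Finset.sum_add_distrib, ← Finset.sum_add_distrib,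
      ← Finset.sum_add_distrib]
    exact Finset.sum_congr rfl fun j _ ↦ by ring
  have e2 : ∑ i, ∑ j, w i j * (ε i + δ j - 1) =
      ∑ i, ε i * ∑ j, w i j + ∑ j, δ j * ∑ i, pairWeight q p j i - ∑ i, ∑ j, w i j := by
    have : ∑ j, δ j * ∑ i, pairWeight q p j i = ∑ i, ∑ j, δ j * w i j := by
      rw [Finset.sum_comm]
      refine Finset.sum_congr rfl fun j _ ↦ ?_
      rw [Finset.mul_sum]
      exact Finset.sum_congr rfl fun i _ ↦ by rw [pairWeight_comm]
    rw [this, ← Finset.sum_add_distrib, ← Finset.sum_sub_distrib]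
    refine Finset.sum_congr rfl fun i _ ↦ ?_
    rw [Finset.mul_sum, ← Finset.sum_add_distrib, ← Finset.sum_sub_distrib]
    exact Finset.sum_congr rfl fun j _ ↦ by ring
  have e3 : ∑ i, ε i * (lam i * (L + 1) + ∑ j, w i j) =
      ∑ j, ε j * (lam j * (L + 1)) + ∑ i, ε i * ∑ j, w i j := by
    rw [← Finset.sum_add_distrib]
    exact Finset.sum_congr rfl fun j _ ↦ by ring
  have e4 : ∑ i, δ i * (mu i * (K + 1) + ∑ j, pairWeight q p i j) =
      ∑ j, δ j * (mu j * (K + 1)) + ∑ i, δ i * ∑ j, pairWeight q p i j := by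
    rw [← Finset.sum_add_distrib]
    exact Finset.sum_congr rfl fun j _ ↦ by ring
  have hAc : (A.card : ℝ) ≤ a + ∑ j, ε j := hA.card_le
  have hBc : (A.card : ℝ) ≤ b + ∑ j, δ j := hAB ▸ hB.card_le
  change ∑ j, (lam j * (b + (L + 1) * (ε j - 1)) + mu j * (a + (K + 1) * (δ j - 1))) ≤ _ at h1
  change ∑ i, ∑ j, w i j * (ε i + δ j - 1) ≤ _ at h2
  change ∑ i, ε i * (1 + L / (K + 1) + ∑ j, mu j) ≤
    ∑ i, ε i * (lam i * (L + 1) + ∑ j, w i j) at h3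
  change ∑ i, δ i * (1 + K / (L + 1) + ∑ j, lam j) ≤
    ∑ i, δ i * (mu i * (K + 1) + ∑ j, pairWeight q p i j) at h4
  rw [e1] at h1
  rw [e2] at h2
  rw [e3, ← Finset.sum_mul] at h3
  rw [e4, ← Finset.sum_mul] at h4
  change ((K : ℝ) + L + 1) * (a / (K + 1) + b / (L + 1)) - (K + L + 1) ≤ _ at h0
  have hcA : (0 : ℝ) ≤ 1 + L / (K + 1) + ∑ j, mu j := by positivity
  have hcB : (0 : ℝ) ≤ 1 + K / (L + 1) + ∑ j, lam j := by positivity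
  have h5 := mul_le_mul_of_nonneg_right hAc hcA
  have h6 := mul_le_mul_of_nonneg_right hBc hcB
  have e5 : ((K : ℝ) + L + 1) * (a / (K + 1) + b / (L + 1)) =
      a * (1 + L / (K + 1)) + b * (1 + K / (L + 1)) := by
    field_simp
    ring
  have e6 : ((K : ℝ) + L + 1) * (1 / (K + 1) + 1 / (L + 1)) =
      (1 + L / (K + 1)) + (1 + K / (L + 1)) := by
    field_simp
    ring
  rw [e5] at h0
  rw [e6, ← hlmsum]
  have h7 : (∑ j, lam j) * (L + 1) + (∑ j, mu j) * (K + 1) ≤ ((K : ℝ) + L + 2) * n := by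
    rw [← hlmsum]
    have := mul_nonneg hl0 (by positivity : (0 : ℝ) ≤ K + 1)
    have := mul_nonneg hm0 (by positivity : (0 : ℝ) ≤ L + 1)
    linarith
  rw [← hlmsum] at h7 hw1
  linarith

lemma ten_thirds_le {K L : ℕ} (hK : 1 ≤ K) (hKL : 2 ≤ K ∨ 2 ≤ L) :
    (10 / 3 : ℝ) ≤ ((K : ℝ) + L + 1) * (1 / (K + 1) + 1 / (L + 1)) := by
  have hint (t : ℤ) : 0 ≤ t * (t + 1) := by
    rcases le_or_gt 0 t with h | h
    · positivity
    · exact mul_nonneg_of_nonpos_of_nonpos h.le (by omega)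
  have key : 10 * (((K : ℤ) + 1) * (L + 1)) ≤ 3 * ((K + L + 1) * (K + L + 2)) := by
    obtain ⟨k, rfl⟩ := Nat.exists_eq_add_of_le hK
    push_cast
    rcases hKL with h | h
    · obtain ⟨k, rfl⟩ := Nat.exists_eq_add_of_le (by omega : 1 ≤ k)
      push_cast
      rcases Nat.eq_zero_or_pos L with rfl | hL
      · push_cast
        nlinarith
      · obtain ⟨l, rfl⟩ := Nat.exists_eq_add_of_le hL
        push_cast
        nlinarith [hint (k - l), hint (l - 1), sq_nonneg (k : ℤ)]
    · obtain ⟨l, rfl⟩ := Nat.exists_eq_add_of_le h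
      push_cast
      nlinarith [hint (l - k), hint (k - 1), sq_nonneg (l : ℤ)]
  have key' : 10 * (((K : ℝ) + 1) * (L + 1)) ≤ 3 * ((K + L + 1) * (K + L + 2)) := by
    exact_mod_cast key
  have : ((K : ℝ) + L + 1) * (1 / (K + 1) + 1 / (L + 1)) =
      (K + L + 1) * (K + L + 2) / ((K + 1) * (L + 1)) := by
    field_simp
    ring
  rw [this, div_le_div_iff₀ (by norm_num) (by positivity)]
  linarith

end Counting

theorem IsSpanningPair.card_base_le {n : ℕ} {A B : Finset (Lat n)} (h : IsSpanningPair A B)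
    (hAB : A.card = B.card) (hsum : ((A + B).card : ℝ) ≤ (n + 3 + 1 / 7) * A.card)
    (hA : 42 * ((n : ℝ) + 1) * (base A).card ≤ A.card)
    (hB : 42 * ((n : ℝ) + 1) * (base B).card ≤ A.card) (hN : 7 * n ^ 2 < A.card) :
    (base A).card ≤ n + 2 ∧ (base B).card ≤ n + 2 := by
  obtain ⟨A', B', h', hst, hA', hB', hbA, hbB, hsum'⟩ := h.exists_isStable (A.card + B.card)
  obtain ⟨K, L, hK, hAK, hBL, hside, hKL⟩ := h'.exists_isStar hst (by omega) (by omega)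
  have h1 := hAK.card_base_le
  have h2 := hBL.card_base_le
  by_cases hle : K ≤ 1 ∧ L ≤ 1
  · omega
  · have h3 := hAK.card_add_ge hBL (by omega) hside hKL
    have h4 := ten_thirds_le hK (L := L) (by omega)
    have h5 : ((A' + B').card : ℝ) ≤ (A + B).card := Nat.cast_le.2 hsum'
    have h6 : (K : ℝ) + 1 ≤ (base A).card := by exact_mod_cast hbA ▸ hAK.lt_card_base
    have h7 : (L : ℝ) + 1 ≤ (base B).card := by exact_mod_cast hbB ▸ hBL.lt_card_base
    have h8 : (7 * n ^ 2 : ℝ) < A.card := by exact_mod_cast hN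
    rw [hA'] at h3
    have h9 := mul_le_mul_of_nonneg_right h4 (Nat.cast_nonneg (α := ℝ) A.card)
    have h10 := mul_le_mul_of_nonneg_left h6 (by positivity : 0 ≤ 42 * ((n : ℝ) + 1))
    have h11 := mul_le_mul_of_nonneg_left h7 (by positivity : 0 ≤ 42 * ((n : ℝ) + 1))
    exfalso
    linarith

section Coordinates

variable {k : ℕ}

/-- The projection setting the coordinate `i` to zero. -/
def dropCoord (i : Fin k) : (Fin k → ℝ) →+ (Fin k → ℝ) :=
  AddMonoidHom.mk' (fun x ↦ Function.update x i 0) fun x y ↦ by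
    rw [← Function.update_add, add_zero]

lemma dropCoord_apply_self (i : Fin k) (x : Fin k → ℝ) : dropCoord i x i = 0 :=
  Function.update_self ..

lemma dropCoord_apply_of_ne {i j : Fin k} (h : j ≠ i) (x : Fin k → ℝ) : dropCoord i x j = x j :=
  Function.update_of_ne h ..

lemma dropCoord_dropCoord (i : Fin k) (x : Fin k → ℝ) :
    dropCoord i (dropCoord i x) = dropCoord i x :=
  Function.update_idem ..

lemma dropCoord_eq_self {i : Fin k} {x : Fin k → ℝ} (h : x i = 0) : dropCoord i x = x :=
  Function.update_eq_self_iff.2 h.symm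

lemma dropCoord_single (i : Fin k) : dropCoord i (Pi.single i 1) = 0 := by
  ext j
  rcases eq_or_ne j i with rfl | h
  · exact dropCoord_apply_self _ _
  · rw [dropCoord_apply_of_ne h, Pi.single_eq_of_ne h, Pi.zero_apply]

lemma eq_smul_single_of_dropCoord_eq_zero {i : Fin k} {x : Fin k → ℝ} (h : dropCoord i x = 0) :
    x = x i • Pi.single i 1 := by
  ext j
  rcases eq_or_ne j i with rfl | hj
  · simp
  · rw [← dropCoord_apply_of_ne hj x, h]
    simp [hj]

/-- The compression of `A` along the coordinate `i`. -/
noncomputable def compressCoord (i : Fin k) (A : Finset (Fin k → ℝ)) : Finset (Fin k → ℝ) :=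
  compress (dropCoord i) (Pi.single i 1) A

variable {A B : Finset (Fin k → ℝ)} {i : Fin k}

lemma single_one_ne_zero (i : Fin k) : (Pi.single i 1 : Fin k → ℝ) ≠ 0 := by simp

lemma mem_compressCoord {x : Fin k → ℝ} : x ∈ compressCoord i A ↔
    ∃ m < (A.filter (dropCoord i · = dropCoord i x)).card,
      x = dropCoord i x + m • Pi.single i 1 :=
  mem_compress (dropCoord_dropCoord i) (dropCoord_single i)

lemma exists_natCast_eq_of_mem_compressCoord {x : Fin k → ℝ} (hx : x ∈ compressCoord i A) :
    ∃ m : ℕ, x i = m := by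
  obtain ⟨m, -, hm⟩ := mem_compressCoord.1 hx
  exact ⟨m, by rw [hm]; simp [dropCoord_apply_self]⟩

lemma exists_dropCoord_eq_of_mem_compressCoord {x : Fin k → ℝ} (hx : x ∈ compressCoord i A) :
    ∃ a ∈ A, dropCoord i a = dropCoord i x := by
  obtain ⟨m, hm, -⟩ := mem_compressCoord.1 hx
  obtain ⟨a, ha⟩ := Finset.card_pos.1 (Nat.zero_lt_of_lt hm)
  exact ⟨a, Finset.mem_filter.1 ha⟩

lemma mem_compressCoord_of_apply_eq_zero {x : Fin k → ℝ} (hx : x ∈ A) (h : x i = 0) :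
    x ∈ compressCoord i A :=
  mem_compress_of_fixed (dropCoord_dropCoord i) (dropCoord_single i) hx (dropCoord_eq_self h)

lemma single_mem_compressCoord (h0 : 0 ∈ A) {j : Fin k} (hj : Pi.single j 1 ∈ A) :
    Pi.single j 1 ∈ compressCoord i A := by
  rcases eq_or_ne i j with rfl | hij
  · have := add_mem_compress (dropCoord_dropCoord i) (dropCoord_single i) h0 hj
      (single_one_ne_zero i).symm (by rw [dropCoord_single, map_zero]) (map_zero _)
    simpa [compressCoord] using this
  · exact mem_compressCoord_of_apply_eq_zero hj (by simp [hij])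

lemma card_compressCoord : (compressCoord i A).card = A.card :=
  card_compress (dropCoord_dropCoord i) (dropCoord_single i) (single_one_ne_zero i)

lemma card_compressCoord_add_le : (compressCoord i A + compressCoord i B).card ≤ (A + B).card :=
  card_compress_add_le (dropCoord_dropCoord i) (dropCoord_single i) (single_one_ne_zero i)

lemma compressCoord_filter_eq_zero :
    (compressCoord i A).filter (· i = 0) = A.image (dropCoord i) := by
  ext x
  rw [Finset.mem_filter, Finset.mem_image]
  constructor
  · rintro ⟨hx, hx0⟩
    obtain ⟨a, ha, hax⟩ := exists_dropCoord_eq_of_mem_compressCoord hx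
    exact ⟨a, ha, by rw [hax, dropCoord_eq_self hx0]⟩
  · rintro ⟨a, ha, rfl⟩
    refine ⟨mem_compressCoord.2 ⟨0, ?_, ?_⟩, dropCoord_apply_self _ _⟩
    · exact Finset.card_pos.2 ⟨a, by simp [ha, dropCoord_dropCoord]⟩
    · simp [dropCoord_dropCoord]

/-- `A'` arises from `A` by compressions along the coordinates in `S`, the first one along `o`. -/
structure IsReduction (o : Fin k) (S : Finset (Fin k)) (A A' : Finset (Fin k → ℝ)) : Prop where
  natCast : ∀ i ∈ S, ∀ a ∈ A', ∃ m : ℕ, a i = m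
  zero_mem : 0 ∈ A'
  single_mem : ∀ i ≠ o, Pi.single i 1 ∈ A → Pi.single i 1 ∈ A'
  sub_mem : ∀ a ∈ A', a o ≠ 0 → a - Pi.single o 1 ∈ A'
  card_eq : A'.card = A.card
  card_filter_eq : (A'.filter (· o = 0)).card = (A.image (dropCoord o)).card

lemma isReduction_compressCoord {o : Fin k} (h : 0 ∈ A) :
    IsReduction o {o} A (compressCoord o A) where
  natCast i hi a ha := by
    rw [Finset.mem_singleton.1 hi]
    exact exists_natCast_eq_of_mem_compressCoord ha
  zero_mem := mem_compressCoord_of_apply_eq_zero h rfl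
  single_mem i _ := single_mem_compressCoord h
  sub_mem a ha h0 := by
    obtain ⟨m, hm, h⟩ := mem_compressCoord.1 ha
    have h1 : dropCoord o (a - Pi.single o 1) = dropCoord o a := by
      rw [map_sub, dropCoord_single, sub_zero]
    obtain _ | m := m
    · rw [zero_smul, add_zero] at h
      exact absurd (h ▸ dropCoord_apply_self o a) h0
    · refine mem_compressCoord.2 ⟨m, by rw [h1]; omega, ?_⟩
      rw [h1]
      nth_rw 1 [h]
      rw [succ_nsmul]
      abel
  card_eq := card_compressCoord
  card_filter_eq := by rw [compressCoord_filter_eq_zero]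

lemma IsReduction.compressCoord {o : Fin k} {S : Finset (Fin k)} {A' : Finset (Fin k → ℝ)}
    (h : IsReduction o S A A') (hi : i ≠ o) :
    IsReduction o (insert i S) A (compressCoord i A') where
  natCast j hj a ha := by
    rcases eq_or_ne j i with rfl | hji
    · exact exists_natCast_eq_of_mem_compressCoord ha
    · obtain ⟨b, hb, hba⟩ := exists_dropCoord_eq_of_mem_compressCoord ha
      obtain ⟨m, hm⟩ := h.natCast j (Finset.mem_of_mem_insert_of_ne hj hji) b hb
      exact ⟨m, by rw [← hm, ← dropCoord_apply_of_ne hji a, ← hba, dropCoord_apply_of_ne hji b]⟩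
  zero_mem := mem_compressCoord_of_apply_eq_zero h.zero_mem rfl
  single_mem j hj hjA := single_mem_compressCoord h.zero_mem (h.single_mem j hj hjA)
  sub_mem := compress_sub_mem (dropCoord_dropCoord i) (dropCoord_single i) (· o ≠ 0)
    (fun x ↦ by rw [dropCoord_apply_of_ne hi.symm]) (dropCoord_eq_self (by simp [hi])) h.sub_mem
  card_eq := card_compressCoord.trans h.card_eq
  card_filter_eq := by
    rw [SumsetLines.compressCoord, ← compress_filter (dropCoord_dropCoord i) (dropCoord_single i)
      (· o = 0) fun x ↦ by rw [dropCoord_apply_of_ne hi.symm]]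
    exact card_compressCoord.trans h.card_filter_eq

lemma exists_isReduction {o : Fin k} (hA : 0 ∈ A) (hB : 0 ∈ B) (S : Finset (Fin k)) :
    ∃ A' B', IsReduction o (insert o S) A A' ∧ IsReduction o (insert o S) B B' ∧
      (A' + B').card ≤ (A + B).card := by
  induction S using Finset.induction_on with
  | empty => exact ⟨_, _, isReduction_compressCoord hA, isReduction_compressCoord hB,
      card_compressCoord_add_le⟩
  | insert i S hi ih =>
    obtain ⟨A', B', hA', hB', h⟩ := ih
    rcases eq_or_ne i o with rfl | hio
    · rw [Finset.insert_idem]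
      exact ⟨A', B', hA', hB', h⟩
    · rw [Finset.insert_comm]
      exact ⟨_, _, hA'.compressCoord hio, hB'.compressCoord hio,
        card_compressCoord_add_le.trans h⟩

end Coordinates

section Cast

variable {n : ℕ}

/-- The embedding of the lattice into real space. -/
def latCast : Lat n →+ (Fin (n + 2) → ℝ) :=
  AddMonoidHom.mk' (fun a ↦ Matrix.vecCons (a.1 : ℝ) (Matrix.vecCons (a.2.1 : ℝ) fun j ↦ a.2.2 j))
    fun a b ↦ by
      ext i
      refine Fin.cases (Int.cast_add _ _) (fun i ↦ ?_) i
      exact Fin.cases (Int.cast_add _ _) (fun j ↦ Int.cast_add _ _) i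

lemma latCast_zero (a : Lat n) : latCast a 0 = a.1 := rfl

lemma latCast_ext {a : Lat n} {x : Fin (n + 2) → ℝ} (h0 : a.1 = x 0) (h1 : a.2.1 = x 1)
    (h : ∀ j : Fin n, a.2.2 j = x j.succ.succ) : latCast a = x := by
  ext i
  refine Fin.cases h0 (fun i ↦ ?_) i
  exact Fin.cases h1 h i

lemma latCast_injective : Function.Injective (latCast (n := n)) := by
  intro a b h
  refine Prod.ext ?_ (Prod.ext ?_ (funext fun j ↦ ?_))
  · exact Int.cast_injective (α := ℝ) (congrFun h 0)
  · exact Int.cast_injective (α := ℝ) (congrFun h 1)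
  · exact Int.cast_injective (α := ℝ) (congrFun h j.succ.succ)

lemma latCast_height : latCast (n := n) (1, 0, 0) = Pi.single 0 1 :=
  latCast_ext (by simp) (by simp) (by simp [Fin.ext_iff])

lemma latCast_axisPt : latCast (n := n) (axisPt 1) = Pi.single 1 1 :=
  latCast_ext (by simp [axisPt]) (by simp [axisPt]) (by simp [axisPt, Fin.ext_iff])

lemma latCast_sidePt (i : Fin n) : latCast (sidePt i) = Pi.single i.succ.succ 1 :=
  latCast_ext (by simp [sidePt, Fin.ext_iff]) (by simp [sidePt, Fin.ext_iff])
    (by simp [sidePt, Pi.single_apply])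

/-- The points of the lattice which are mapped into `A`. -/
noncomputable def latPreimage (A : Finset (Fin (n + 2) → ℝ)) : Finset (Lat n) :=
  A.preimage latCast latCast_injective.injOn

lemma mem_latPreimage {A : Finset (Fin (n + 2) → ℝ)} {a : Lat n} :
    a ∈ latPreimage A ↔ latCast a ∈ A := Finset.mem_preimage

namespace IsReduction

variable {A A' : Finset (Fin (n + 2) → ℝ)} {S : Finset (Fin (n + 2))}
  (h : IsReduction 0 S A A') (hS : ∀ i, i ∈ S)
include h hS

lemma image_latPreimage : (latPreimage A').image latCast = A' := by
  refine subset_antisymm (Finset.image_subset_iff.2 fun a ↦ mem_latPreimage.1) fun x hx ↦ ?_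
  choose m hm using fun i ↦ h.natCast i (hS i) x hx
  have : latCast (m 0, m 1, fun j ↦ m j.succ.succ) = x :=
    latCast_ext (by simp [hm]) (by simp [hm]) (by simp [hm])
  exact Finset.mem_image.2 ⟨_, mem_latPreimage.2 (this ▸ hx), this⟩

lemma isTower : IsTower (latPreimage A') where
  nonneg a ha := by
    rw [mem_latPreimage] at ha
    choose m hm using fun i ↦ h.natCast i (hS i) _ ha
    have hnn (i) : 0 ≤ latCast a i := (hm i).symm ▸ Nat.cast_nonneg _
    exact ⟨Int.cast_nonneg_iff.1 (hnn 0), Int.cast_nonneg_iff.1 (hnn 1),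
      fun j ↦ Int.cast_nonneg_iff.1 (hnn j.succ.succ)⟩
  zero_mem := mem_latPreimage.2 (by rw [map_zero]; exact h.zero_mem)
  sub_mem a ha h1 := by
    rw [mem_latPreimage] at ha ⊢
    rw [map_sub, latCast_height]
    refine h.sub_mem _ ha ?_
    rw [latCast_zero]
    exact_mod_cast (by omega : a.1 ≠ 0)

lemma card_latPreimage : (latPreimage A').card = A.card := by
  rw [← h.card_eq, ← Finset.card_image_of_injective _ latCast_injective, h.image_latPreimage hS]

lemma card_base_latPreimage : (base (latPreimage A')).card = (A.image (dropCoord 0)).card := by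
  rw [← h.card_filter_eq, ← Finset.card_image_of_injective _ latCast_injective]
  congr 1
  nth_rw 2 [← h.image_latPreimage hS]
  rw [Finset.filter_image, base]
  simp only [latCast_zero, Int.cast_eq_zero]

end IsReduction

/-- The combinatorial core: if the two sets have small sumset and are contained in comparatively
few lines in the direction of the first coordinate, then the number of lines is at most the
dimension. -/
theorem card_image_dropCoord_le {A B : Finset (Fin (n + 2) → ℝ)} (hA0 : 0 ∈ A) (hB0 : 0 ∈ B)
    (hsingle : ∀ i ≠ 0, Pi.single i 1 ∈ A) (hAB : A.card = B.card)
    (hsum : ((A + B).card : ℝ) ≤ (n + 3 + 1 / 7) * A.card)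
    (hA : 42 * ((n : ℝ) + 1) * (A.image (dropCoord 0)).card ≤ A.card)
    (hB : 42 * ((n : ℝ) + 1) * (B.image (dropCoord 0)).card ≤ A.card) (hN : 7 * n ^ 2 < A.card) :
    (A.image (dropCoord 0)).card ≤ n + 2 ∧ (B.image (dropCoord 0)).card ≤ n + 2 := by
  obtain ⟨A', B', hA', hB', h⟩ := exists_isReduction (o := 0) hA0 hB0 Finset.univ
  have hS (i : Fin (n + 2)) : i ∈ insert 0 Finset.univ := by simp
  have hpair : IsSpanningPair (latPreimage A') (latPreimage B') := by
    refine ⟨hA'.isTower hS, hB'.isTower hS, mem_latPreimage.2 ?_,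
      fun j ↦ .inl (mem_latPreimage.2 ?_)⟩
    · rw [latCast_axisPt]
      exact hA'.single_mem 1 (by simp) (hsingle 1 (by simp))
    · rw [latCast_sidePt]
      exact hA'.single_mem _ (Fin.succ_ne_zero _) (hsingle _ (Fin.succ_ne_zero _))
  have hcard := hA'.card_latPreimage hS
  have hle : (latPreimage A' + latPreimage B').card ≤ (A + B).card := by
    rw [← Finset.card_image_of_injective _ latCast_injective, Finset.image_add,
      hA'.image_latPreimage hS, hB'.image_latPreimage hS]
    exact h
  have := hpair.card_base_le (by rw [hcard, hB'.card_latPreimage hS, hAB])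
    (by rw [hcard]; exact (Nat.cast_le.2 hle).trans hsum)
    (by rwa [hcard, hA'.card_base_latPreimage hS])
    (by rwa [hcard, hB'.card_base_latPreimage hS]) (by rwa [hcard])
  rwa [hA'.card_base_latPreimage hS, hB'.card_base_latPreimage hS] at this

end Cast

/-- A nonzero vector `s` can be completed to a basis by vectors of a given spanning set. -/
theorem exists_basis_of_span_eq_top {n : ℕ} {K V : Type*} [DivisionRing K] [AddCommGroup V]
    [Module K V] (hV : Module.finrank K V = n + 1) {S : Set V} (hS : Submodule.span K S = ⊤)
    {s : V} (hs : s ≠ 0) :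
    ∃ b : Module.Basis (Fin (n + 1)) K V, b 0 = s ∧ ∀ i ≠ 0, b i ∈ S := by
  have : Module.Finite K V := Module.finite_of_finrank_eq_succ hV
  have hli : LinearIndepOn K id {s} := LinearIndepOn.singleton hs
  have hsub : {s} ⊆ insert s S := by simp
  have htop : ⊤ ≤ Submodule.span K (insert s S) :=
    hS.ge.trans (Submodule.span_mono (Set.subset_insert _ _))
  set b := Module.Basis.extendLe hli hsub htop
  have : Fintype (hli.extend hsub) := FiniteDimensional.fintypeBasisIndex b
  obtain ⟨j, hj⟩ : s ∈ Set.range b := Module.Basis.subset_extendLe hli hsub htop rfl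
  let e := Fintype.equivFinOfCardEq ((Module.finrank_eq_card_basis b).symm.trans hV)
  have h0 : (b.reindex (e.trans (Equiv.swap (e j) 0))) 0 = s := by simp [hj]
  refine ⟨_, h0, fun i hi ↦ ?_⟩
  refine Set.mem_of_mem_insert_of_ne (s := S) ?_ (h0 ▸ (Module.Basis.injective _).ne hi)
  rw [Module.Basis.reindex_apply]
  exact Module.Basis.extendLe_subset hli hsub htop ⟨_, rfl⟩

/-- If few translates of the line spanned by `s` cover `A`, then one of them is rich in `A`. -/
theorem exists_rich_line {V : Type*} [AddCommGroup V] [Module ℝ V] {H : Type*} [AddCommGroup H]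
    {A : Finset V} (hA : A.Nonempty) {d : ℕ} {s : V} (q : V →+ H)
    (hq : ∀ x, q x = 0 → ∃ t : ℝ, x = t • s) (hcard : (A.image q).card ≤ d) :
    ∃ x : V, (A.card : ℝ) / d ≤
      ((A : Set V) ∩ (x +ᵥ (Submodule.span ℝ {s} : Set V))).ncard := by
  obtain ⟨c, hc⟩ := exists_card_le_card_image_mul hA q
  have hd : 0 < d := (Finset.card_pos.2 (hA.image q)).trans_le hcard
  obtain ⟨x, hx⟩ : (A.filter (q · = c)).Nonempty := by
    rw [← Finset.card_pos]
    exact Nat.pos_of_mul_pos_left (hA.card_pos.trans_le hc)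
  have hsub : (↑(A.filter (q · = c)) : Set V) ⊆
      (A : Set V) ∩ (x +ᵥ (Submodule.span ℝ {s} : Set V)) := by
    intro a ha
    rw [Finset.mem_coe] at ha
    rw [Finset.mem_filter] at ha hx
    refine ⟨ha.1, Set.mem_vadd_set.2 ⟨a - x, ?_, by simp⟩⟩
    obtain ⟨t, ht⟩ := hq (a - x) (by rw [map_sub, ha.2, hx.2, sub_self])
    exact Submodule.mem_span_singleton.2 ⟨t, ht.symm⟩
  have h1 := Set.ncard_le_ncard hsub (A.finite_toSet.inter_of_left _)
  rw [Set.ncard_coe_finset] at h1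
  refine ⟨x, (div_le_iff₀' (by exact_mod_cast hd)).2 ?_⟩
  exact_mod_cast hc.trans (Nat.mul_le_mul hcard h1)

/-- Two large sets with small sumset which are covered by comparatively few lines in direction `s`
are covered by as many such lines as the dimension. -/
theorem exists_card_image_le {n : ℕ} {A B : Finset (Fin (n + 2) → ℝ)} (hB0 : B.Nonempty)
    (hspan : vectorSpan ℝ (A : Set (Fin (n + 2) → ℝ)) = ⊤) (hAB : A.card = B.card)
    (hsum : ((A + B).card : ℝ) ≤ (n + 3 + 1 / 7) * A.card) (hN : 7 * n ^ 2 < A.card)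
    {s : Fin (n + 2) → ℝ} (hs : s ≠ 0)
    (h : ∀ q : (Fin (n + 2) → ℝ) →+ (Fin (n + 2) → ℝ), q s = 0 →
      ((A.image q).card : ℝ) ≤ 1 / (42 * ((n : ℝ) + 1)) * A.card ∧
      ((B.image q).card : ℝ) ≤ 1 / (42 * ((n : ℝ) + 1)) * A.card) :
    ∃ q : (Fin (n + 2) → ℝ) →+ (Fin (n + 2) → ℝ), (∀ x, q x = 0 → ∃ t : ℝ, x = t • s) ∧
      (A.image q).card ≤ n + 2 ∧ (B.image q).card ≤ n + 2 := by
  obtain ⟨a₀, ha₀⟩ : A.Nonempty := by rw [← Finset.card_pos]; omega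
  obtain ⟨b₀, hb₀⟩ := hB0
  rw [vectorSpan_eq_span_vsub_set_right ℝ ha₀] at hspan
  obtain ⟨b, hb, hbA⟩ := exists_basis_of_span_eq_top (Module.finrank_fin_fun ℝ) hspan hs
  let f : (Fin (n + 2) → ℝ) ≃+ (Fin (n + 2) → ℝ) := b.equivFun.toAddEquiv
  let g (c : Fin (n + 2) → ℝ) (x : Fin (n + 2) → ℝ) : Fin (n + 2) → ℝ := f (x - c)
  have hf (i : Fin (n + 2)) : f (b i) = Pi.single i 1 := by
    ext j
    simp [f, Pi.single_apply, eq_comm]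
  have hg (c) : Function.Injective (g c) := f.injective.comp sub_left_injective
  let q : (Fin (n + 2) → ℝ) →+ (Fin (n + 2) → ℝ) := (dropCoord 0).comp f.toAddMonoidHom
  have hqs : q s = 0 := by
    rw [← hb]
    exact (congrArg _ (hf 0)).trans (dropCoord_single 0)
  have himage (X : Finset (Fin (n + 2) → ℝ)) (c) :
      ((X.image (g c)).image (dropCoord 0)).card = (X.image q).card := by
    rw [← Finset.card_image_of_injective (X.image q) (sub_left_injective (b := q c)),
      Finset.image_image, Finset.image_image]
    congr 2
    ext1 x
    exact map_sub q x c
  have hadd : A.image (g a₀) + B.image (g b₀) = (A + B).image (g (a₀ + b₀)) := by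
    ext x
    simp only [Finset.mem_add, Finset.mem_image]
    constructor
    · rintro ⟨_, ⟨a, ha, rfl⟩, _, ⟨b, hb, rfl⟩, rfl⟩
      exact ⟨a + b, ⟨a, ha, b, hb, rfl⟩, by simp only [g, ← map_add]; congr 1; abel⟩
    · rintro ⟨_, ⟨a, ha, b, hb, rfl⟩, rfl⟩
      exact ⟨_, ⟨a, ha, rfl⟩, _, ⟨b, hb, rfl⟩, by simp only [g, ← map_add]; congr 1; abel⟩
  have hpos : (0 : ℝ) < 42 * ((n : ℝ) + 1) := by positivity
  obtain ⟨h1, h2⟩ := h q hqs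
  rw [one_div, inv_mul_eq_div, le_div_iff₀' hpos] at h1 h2
  have hcA := Finset.card_image_of_injective A (hg a₀)
  have key := card_image_dropCoord_le (A := A.image (g a₀)) (B := B.image (g b₀))
    (Finset.mem_image.2 ⟨a₀, ha₀, by simp [g]⟩) (Finset.mem_image.2 ⟨b₀, hb₀, by simp [g]⟩)
    (fun i hi ↦ by
      obtain ⟨a, ha, hai⟩ := hbA i hi
      exact Finset.mem_image.2 ⟨a, ha, by rw [← hf, ← hai]; rfl⟩)
    (by rw [hcA, Finset.card_image_of_injective B (hg b₀), hAB])
    (by rw [hadd, hcA, Finset.card_image_of_injective _ (hg _)]; exact hsum)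
    (by rw [himage, hcA]; exact h1) (by rw [himage, hcA]; exact h2) (by rw [hcA]; exact hN)
  rw [himage, himage] at key
  refine ⟨q, fun x hx ↦ ⟨f x 0, f.injective ?_⟩, key⟩
  have hfx : f x = f x 0 • Pi.single 0 1 := eq_smul_single_of_dropCoord_eq_zero hx
  rw [← hf, hb] at hfx
  exact hfx.trans (map_smul b.equivFun _ s).symm

end SumsetLines

theorem stmt_2 (d : ℕ) :
    ∃ C K : ℝ, ∀ A B : Finset (Fin d → ℝ),
      Module.finrank ℝ (affineSpan ℝ (A : Set (Fin d → ℝ))).direction = d →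
      A.card = B.card →
      ((A + B).card : ℝ) ≤ (A.card : ℝ) + (d + 1 / 7) * B.card - C →
      (A.card : ℝ) ≤ K ∨
        ∃ l : Submodule ℝ (Fin d → ℝ), Module.finrank ℝ l = 1 ∧
          ∃ x y : Fin d → ℝ,
            (A.card : ℝ) / d
              ≤ (((A : Set (Fin d → ℝ)) ∩ (x +ᵥ (l : Set (Fin d → ℝ)))).ncard : ℝ) ∧
            (B.card : ℝ) / d
              ≤ (((B : Set (Fin d → ℝ)) ∩ (y +ᵥ (l : Set (Fin d → ℝ)))).ncard : ℝ) := by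
  obtain _ | _ | n := d
  · exact ⟨0, 1, fun A _ _ _ _ ↦ .inl (by exact_mod_cast Finset.card_le_one_of_subsingleton A)⟩
  · refine ⟨0, 0, fun A B _ _ _ ↦ .inr ⟨⊤, by simp, 0, 0, ?_, ?_⟩⟩ <;> simp
  · have hη : 1 / (42 * ((n : ℝ) + 1)) < 1 := by
      rw [div_lt_one (by positivity)]
      linarith [n.cast_nonneg (α := ℝ)]
    obtain ⟨N, hN⟩ := SumsetLines.exists_rich_direction (G := Fin (n + 2) → ℝ)
      (K := n + 3 + 1 / 7) (by linarith [n.cast_nonneg (α := ℝ)]) (by positivity) hη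
    refine ⟨0, (max N (7 * n ^ 2) : ℕ), fun A B hdim hAB hsum ↦ or_iff_not_imp_left.2 fun hK ↦ ?_⟩
    rw [Nat.cast_le, not_le, max_lt_iff] at hK
    have hsum' : ((A + B).card : ℝ) ≤ (n + 3 + 1 / 7) * A.card := by
      rw [← hAB] at hsum
      push_cast at hsum
      linarith
    obtain ⟨s, hs, h⟩ := hN A B hK.1.le hAB (by convert hsum'; rfl)
    have hA : A.Nonempty := by rw [← Finset.card_pos]; omega
    have hB : B.Nonempty := by rw [← Finset.card_pos]; omega
    rw [direction_affineSpan] at hdim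
    obtain ⟨q, hq, hqA, hqB⟩ := SumsetLines.exists_card_image_le hB
      (Submodule.eq_top_of_finrank_eq (hdim.trans (Module.finrank_fin_fun ℝ).symm)) hAB hsum' hK.2
      hs fun q hq ↦ by convert h q hq
    obtain ⟨x, hx⟩ := SumsetLines.exists_rich_line (d := n + 2) hA q hq (by convert hqA)
    obtain ⟨y, hy⟩ := SumsetLines.exists_rich_line (d := n + 2) hB q hq (by convert hqB)
    exact ⟨_, finrank_span_singleton hs, x, y, hx, hy⟩
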